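/- arXiv:1509.02829 — 2 statements merged into one kernel-verified Lean document; each statement's English description precedes it below -/
import Mathlib

section
/- Let A ⊆ ℕ = {1,2,…} with 1 ∈ A, A ≠ {1} and A ≠ {1,2}. Let b > 0 satisfy Σ_{k≥0, k+1∈A} (k+1)(k−1)b^k = 0 and set K_A = gcd(A−1) · sqrt( (Σ_{k+1∈A} (k+1)b^k) / (2π Σ_{k+1∈A} (k+1)(k²−1)b^k) ) · (Σ_{k∈A} k b^k). Then #NC_n^A ~ K_A · (Σ_{k+1∈A} (k+1)b^{k−1})^{n−1} · n^{−3/2} as n → ∞ along the subsequence of those n for which NC_n^A ≠ ∅. -/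
open Filter Set

noncomputable section

/-- The position `e^{-2iπk/n}` of the `k`-th among the `n`-th roots of unity,
labelled in clockwise order starting from the complex number `1`. -/
def ncPos (n k : ℕ) : ℂ := Complex.exp (-(2 * Real.pi * Complex.I) * k / n)

/-- A noncrossing tree with `n` vertices: a tree on the vertex set of `n`-th roots of unity
whose edges, drawn as straight line segments, pairwise intersect only at common endpoints. -/
structure NCTree (n : ℕ) where
  adj : SimpleGraph (Fin n)
  isTree : adj.IsTree
  noncrossing : ∀ a b c d : Fin n, adj.Adj a b → adj.Adj c d →
    ({(a : ℕ), (b : ℕ)} : Set ℕ) ≠ {(c : ℕ), (d : ℕ)} →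
    segment ℝ (ncPos n a) (ncPos n b) ∩ segment ℝ (ncPos n c) (ncPos n d) ⊆
      {z : ℂ | (z = ncPos n a ∨ z = ncPos n b) ∧ (z = ncPos n c ∨ z = ncPos n d)}

/-- A plane tree in Neveu's formalism: a finite set of finite words of positive integers,
containing the root `[]`, closed under prefixes, and such that the children of a vertex `u`
are `u1, …, u k_u`. -/
structure PlaneTree where
  verts : Finset (List ℕ)
  root_mem : [] ∈ verts
  prefix_closed : ∀ u v : List ℕ, u <+: v → v ∈ verts → u ∈ verts
  labels_pos : ∀ u ∈ verts, ∀ i ∈ u, 1 ≤ i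
  children_closed : ∀ (u : List ℕ) (i : ℕ), 1 ≤ i → u ++ [i + 1] ∈ verts → u ++ [i] ∈ verts

namespace PlaneTree

/-- The number of children of the vertex `u` in `τ`. -/
def kc (τ : PlaneTree) (u : List ℕ) : ℕ := Set.ncard {i : ℕ | u ++ [i] ∈ τ.verts}

/-- The number of strict descendants of `u` in `τ`. -/
def descCount (τ : PlaneTree) (u : List ℕ) : ℕ :=
  Set.ncard {v : List ℕ | v ∈ τ.verts ∧ u <+: v ∧ v ≠ u}

/-- The number of vertices of the subtree grafted on `u` (that is, `u` and its descendants). -/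
def subtreeSize (τ : PlaneTree) (u : List ℕ) : ℕ :=
  Set.ncard {v : List ℕ | v ∈ τ.verts ∧ u <+: v}

/-- The height of `τ`: the maximal generation of a vertex. -/
def height (τ : PlaneTree) : ℕ := τ.verts.sup List.length

/-- The `j`-th vertex of `τ` in lexicographical order (starting from `j = 0` for the root). -/
def lexVertex (τ : PlaneTree) (j : ℕ) : List ℕ := (τ.verts.sort (· ≤ ·)).getD j []

/-- The Łukasiewicz path of `τ`: `W 0 = 0` and `W (j+1) = W j + k_{u(j)} - 1`, the vertices
being listed in lexicographical order. -/
def lukas (τ : PlaneTree) (j : ℕ) : ℤ :=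
  (((τ.verts.sort (· ≤ ·)).take j).map fun u => (τ.kc u : ℤ) - 1).sum

end PlaneTree

/-- `IsShape n θ τ f` expresses that the plane tree `τ` is the shape of the noncrossing tree
`θ`, the correspondence between the vertices of `τ` and those of `θ` being given by `f`:
`f` is a bijection sending the root of `τ` to the vertex `1` of `θ`, sending parent-child
pairs exactly to edges of `θ`, and the planar (clockwise, starting from the parent) order of
the children of each vertex agrees with their order in `τ`. -/
def IsShape (n : ℕ) (θ : NCTree n) (τ : PlaneTree) (f : List ℕ → Fin n) : Prop :=
  τ.verts.card = n ∧
  Set.BijOn f (↑τ.verts) Set.univ ∧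
  (f ([] : List ℕ)).val = 0 ∧
  (∀ u ∈ τ.verts, u ≠ [] → θ.adj.Adj (f u.dropLast) (f u)) ∧
  (∀ u ∈ τ.verts, ∀ v ∈ τ.verts, θ.adj.Adj (f u) (f v) → u = v.dropLast ∨ v = u.dropLast) ∧
  (∀ u ∈ τ.verts, ∀ i j : ℕ, 1 ≤ i → i < j → u ++ [j] ∈ τ.verts →
    f (u ++ [i]) - f u.dropLast < f (u ++ [j]) - f u.dropLast)

/-- `leftOf z w` : the point `w` lies in the (open) left half-plane bounded by the oriented
line from `z` to the complex number `1`. -/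
def leftOf (z w : ℂ) : Prop := 0 < ((starRingEnd ℂ) (1 - z) * (w - z)).im

/-- The number of children of the vertex of `θ` corresponding to the vertex `u` of its shape
`τ` which lie to the left of it (in the left half-plane bounded by the line joining it to the
complex number `1`). -/
def leftCount (n : ℕ) (θ : NCTree n) (τ : PlaneTree) (f : List ℕ → Fin n) (u : List ℕ) : ℕ :=
  Set.ncard {i : ℕ | u ++ [i] ∈ τ.verts ∧ leftOf (ncPos n (f u)) (ncPos n (f (u ++ [i])))}

/-- The degree of the vertex `v` in the noncrossing tree `θ`. -/
def ncDeg (n : ℕ) (θ : NCTree n) (v : Fin n) : ℕ := Set.ncard {w : Fin n | θ.adj.Adj v w}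

/-- The noncrossing tree `θ` viewed as the compact subset of the closed unit disk given by
the union of its edges. -/
def ncSet (n : ℕ) (θ : NCTree n) : Set ℂ :=
  ⋃ (a : Fin n) (b : Fin n) (_ : θ.adj.Adj a b), segment ℝ (ncPos n a) (ncPos n b)

end

open scoped Topology


/-! ### Part B1 -/
open Filter Set
open scoped Topology

/-! ## Combinatorial noncrossing trees on integer intervals -/

lemma nct_reach_map {V W : Type*} {G : SimpleGraph V} {H : SimpleGraph W} (f : V → W)
    (hf : ∀ u v, G.Adj u v → H.Reachable (f u) (f v)) {u v : V} (h : G.Reachable u v) :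
    H.Reachable (f u) (f v) := by
  obtain ⟨p⟩ := h
  induction p with
  | nil => exact SimpleGraph.Reachable.refl _
  | cons hadj _ ih => exact (hf _ _ hadj).trans ih

lemma nct_reach_inv {V : Type*} {G : SimpleGraph V} (P : V → Prop)
    (hP : ∀ u v, P u → G.Adj u v → P v) {u v : V} (h : G.Reachable u v) (hu : P u) : P v := by
  obtain ⟨p⟩ := h
  induction p with
  | nil => exact hu
  | cons hadj _ ih => exact ih (hP _ _ hu hadj)

/-- Gluing two acyclic graphs along at most one vertex. -/
lemma nct_acyclic_glue {V : Type*} {G H : SimpleGraph V} (S T : Set V) (c : V)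
    (hG : ∀ u v, G.Adj u v → u ∈ S) (hH : ∀ u v, H.Adj u v → u ∈ T)
    (hST : ∀ x, x ∈ S → x ∈ T → x = c) (aG : G.IsAcyclic) (aH : H.IsAcyclic) :
    (G ⊔ H).IsAcyclic := by
  classical
  have key : ∀ (G H : SimpleGraph V) (S T : Set V), (∀ u v, G.Adj u v → u ∈ S) →
      (∀ u v, H.Adj u v → u ∈ T) → (∀ x, x ∈ S → x ∈ T → x = c) → G.IsAcyclic →
      ∀ u v, G.Adj u v → ¬ ((G ⊔ H).deleteEdges {s(u, v)}).Reachable u v := by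
    intro G H S T hG hH hST aG u v huv hr
    rw [SimpleGraph.isAcyclic_iff_forall_adj_isBridge] at aG
    have h1 := aG huv
    rw [SimpleGraph.isBridge_iff] at h1
    apply h1
    have hfS : ∀ x ∈ S, (if x ∈ T then c else x) = x := by
      intro x hx
      split_ifs with h
      · exact (hST x hx h).symm
      · rfl
    have := nct_reach_map (H := G.deleteEdges {s(u, v)}) (fun x => if x ∈ T then c else x) ?_ hr
    · rwa [hfS u (hG _ _ huv), hfS v (hG _ _ huv.symm)] at this
    · intro x y hxy
      rw [SimpleGraph.deleteEdges_adj, SimpleGraph.sup_adj] at hxy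
      obtain ⟨hxy | hxy, hne⟩ := hxy
      · rw [hfS x (hG _ _ hxy), hfS y (hG _ _ hxy.symm)]
        apply SimpleGraph.Adj.reachable
        rw [SimpleGraph.deleteEdges_adj]
        exact ⟨hxy, hne⟩
      · rw [if_pos (hH _ _ hxy), if_pos (hH _ _ hxy.symm)]
  rw [SimpleGraph.isAcyclic_iff_forall_adj_isBridge]
  intro u v huv
  rw [SimpleGraph.isBridge_iff]
  rcases huv with huv | huv
  · exact key G H S T hG hH hST aG u v huv
  · rw [sup_comm]
    exact key H G T S hH hG (fun x hx hy => hST x hy hx) aH u v huv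

/-- A noncrossing tree on the integer interval `[i, j]`. -/
structure Nct (i j : ℤ) (G : SimpleGraph ℤ) : Prop where
  supp : ∀ u v, G.Adj u v → i ≤ u ∧ u ≤ j
  nc : ∀ a b c d, G.Adj a b → G.Adj c d → a < c → c < b → b < d → False
  acyc : G.IsAcyclic
  conn : ∀ u, i ≤ u → u ≤ j → G.Reachable i u

/-- Restriction of a graph to an interval. -/
def nctR (G : SimpleGraph ℤ) (a b : ℤ) : SimpleGraph ℤ where
  Adj u v := G.Adj u v ∧ (a ≤ u ∧ u ≤ b) ∧ (a ≤ v ∧ v ≤ b)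
  symm := ⟨fun _ _ h => ⟨h.1.symm, h.2.2, h.2.1⟩⟩
  loopless := ⟨fun _ h => G.loopless.irrefl _ h.1⟩

lemma nctR_adj {G : SimpleGraph ℤ} {a b u v : ℤ} :
    (nctR G a b).Adj u v ↔ G.Adj u v ∧ (a ≤ u ∧ u ≤ b) ∧ (a ≤ v ∧ v ≤ b) := Iff.rfl

lemma nctR_le (G : SimpleGraph ℤ) (a b : ℤ) : nctR G a b ≤ G := fun _ _ h => h.1

lemma Nct.restrict {i j a b : ℤ} {G : SimpleGraph ℤ} (h : Nct i j G)
    (hc : ∀ u, a ≤ u → u ≤ b → (nctR G a b).Reachable a u) : Nct a b (nctR G a b) where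
  supp := fun u v huv => huv.2.1
  nc := fun x y z w h1 h2 => h.nc x y z w h1.1 h2.1
  acyc := h.acyc.anti (nctR_le _ _ _)
  conn := hc

lemma nct_single (i : ℤ) (G : SimpleGraph ℤ) : Nct i i G ↔ G = ⊥ := by
  constructor
  · intro h
    ext u v
    simp only [SimpleGraph.bot_adj, iff_false]
    intro huv
    have h1 := h.supp u v huv
    have h2 := h.supp v u huv.symm
    exact huv.ne (by omega)
  · rintro rfl
    refine ⟨by simp, by simp, by simp, ?_⟩
    intro u h1 h2
    have : u = i := by omega
    rw [this]

lemma nct_glue {i c j : ℤ} {P R : SimpleGraph ℤ} (hic : i ≤ c) (hcj : c ≤ j) (hP : Nct i c P)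
    (hR : Nct c j R) : Nct i j (P ⊔ R) where
  supp := by
    rintro u v (h | h)
    · have := hP.supp u v h; omega
    · have := hR.supp u v h; omega
  nc := by
    rintro x y z w (h | h) (h' | h') h1 h2 h3
    · exact hP.nc x y z w h h' h1 h2 h3
    · have := hP.supp y x h.symm; have := hR.supp z w h'; omega
    · have := hR.supp x y h; have := hP.supp w z h'.symm; omega
    · exact hR.nc x y z w h h' h1 h2 h3
  acyc := by
    apply nct_acyclic_glue (Set.Icc i c) (Set.Icc c j) c hP.supp hR.supp _ hP.acyc hR.acyc
    intro x hx hy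
    exact le_antisymm hx.2 hy.1
  conn := by
    intro u h1 h2
    rcases le_total u c with h | h
    · exact (hP.conn u h1 h).mono le_sup_left
    · exact ((hP.conn c hic le_rfl).mono le_sup_left).trans ((hR.conn u h h2).mono le_sup_right)

lemma nct_edge_adj {a b u v : ℤ} : (SimpleGraph.edge a b).Adj u v ↔
    ((u = a ∧ v = b) ∨ (u = b ∧ v = a)) ∧ u ≠ v := by
  rw [SimpleGraph.edge_adj]

lemma nct_join {i s c : ℤ} {L M : SimpleGraph ℤ} (his : i ≤ s) (hsc : s < c) (hL : Nct i s L)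
    (hM : Nct (s + 1) c M) : Nct i c (L ⊔ M ⊔ SimpleGraph.edge i c) where
  supp := by
    rintro u v ((h | h) | h)
    · have := hL.supp u v h; omega
    · have := hM.supp u v h; omega
    · rw [nct_edge_adj] at h; omega
  nc := by
    intro x y z w h h' h1 h2 h3
    simp only [SimpleGraph.sup_adj, nct_edge_adj] at h h'
    rcases h with (h | h) | h <;> rcases h' with (h' | h') | h'
    · exact hL.nc x y z w h h' h1 h2 h3
    · have := hL.supp y x h.symm; have := hM.supp z w h'; omega
    · have := hL.supp y x h.symm; have := hL.supp x y h; omega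
    · have := hM.supp x y h; have := hL.supp w z h'.symm; omega
    · exact hM.nc x y z w h h' h1 h2 h3
    · have := hM.supp y x h.symm; have := hM.supp x y h; omega
    · have := hL.supp w z h'.symm; have := hL.supp z w h'; omega
    · have := hM.supp w z h'.symm; have := hM.supp z w h'; omega
    · omega
  acyc := by
    have h0 : (L ⊔ M).IsAcyclic := by
      apply nct_acyclic_glue (Set.Icc i s) (Set.Icc (s + 1) c) i hL.supp hM.supp _ hL.acyc hM.acyc
      intro x hx hy
      have := hx.2; have := hy.1; omega
    apply SimpleGraph.IsAcyclic.sup_edge_of_not_reachable _ h0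
    intro hr
    have := nct_reach_inv (fun x => x ≤ s) ?_ hr his
    · omega
    · rintro u v hu (h | h)
      · exact (hL.supp v u h.symm).2
      · have := hM.supp u v h; omega
  conn := by
    intro u h1 h2
    rcases le_or_gt u s with h | h
    · exact (hL.conn u h1 h).mono (le_sup_left.trans le_sup_left)
    · have e1 : (L ⊔ M ⊔ SimpleGraph.edge i c).Reachable i c := by
        apply SimpleGraph.Adj.reachable
        right
        rw [nct_edge_adj]; omega
      refine e1.trans ?_
      have e2 : M.Reachable c u := (hM.conn c (by omega) le_rfl).symm.trans (hM.conn u (by omega) h2)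
      exact e2.mono (le_sup_right.trans le_sup_left)

lemma nct_split_right {i c j : ℤ} {G : SimpleGraph ℤ} (h : Nct i j G) (hic : i < c)
    (hadj : G.Adj i c) (hlast : ∀ v, G.Adj i v → v ≤ c) :
    Nct i c (nctR G i c) ∧ Nct c j (nctR G c j) ∧ nctR G i c ⊔ nctR G c j = G := by
  have hcj : c ≤ j := (h.supp c i hadj.symm).2
  have hcross : ∀ u v, G.Adj u v → u < c → v ≤ c := by
    intro u v huv huc
    by_contra hv
    have := h.supp u v huv
    rcases eq_or_lt_of_le this.1 with h1 | h1
    · subst h1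
      exact hv (hlast v huv)
    · exact h.nc i c u v hadj huv h1 huc (by omega)
  refine ⟨h.restrict ?_, h.restrict ?_, ?_⟩
  · intro u h1 h2
    have := nct_reach_map (H := nctR G i c) (fun x => min x c) ?_ (h.conn u h1 (by omega))
    · simpa [min_eq_left h2, min_eq_left hic.le] using this
    · intro x y hxy
      have hx := h.supp x y hxy
      have hy := h.supp y x hxy.symm
      by_cases hxc : x ≤ c
      · by_cases hyc : y ≤ c
        · simp only [min_eq_left hxc, min_eq_left hyc]
          exact SimpleGraph.Adj.reachable ⟨hxy, by omega, by omega⟩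
        · have : x = c := by
            by_contra hne
            have := hcross x y hxy (by omega)
            omega
          subst this
          simp [min_eq_right (le_of_not_ge hyc)]
      · have : c ≤ y := by
          by_contra hne
          have := hcross y x hxy.symm (by omega)
          omega
        simp [min_eq_right this, min_eq_right (le_of_not_ge hxc)]
  · intro u h1 h2
    have := nct_reach_map (H := nctR G c j) (fun x => max x c) ?_
      ((h.conn c hic.le hcj).symm.trans (h.conn u (by omega) h2))
    · simpa [max_eq_left h1] using this
    · intro x y hxy
      have hx := h.supp x y hxy
      have hy := h.supp y x hxy.symm
      by_cases hxc : c ≤ x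
      · by_cases hyc : c ≤ y
        · simp only [max_eq_left hxc, max_eq_left hyc]
          exact SimpleGraph.Adj.reachable ⟨hxy, by omega, by omega⟩
        · have : x = c := by
            have := hcross y x hxy.symm (by omega)
            omega
          subst this
          simp [max_eq_right (le_of_not_ge hyc)]
      · have : y ≤ c := hcross x y hxy (by omega)
        simp [max_eq_right this, max_eq_right (le_of_not_ge hxc)]
  · ext u v
    simp only [SimpleGraph.sup_adj, nctR_adj]
    constructor
    · rintro (h | h) <;> exact h.1
    · intro huv
      have hx := h.supp u v huv
      have hy := h.supp v u huv.symm
      have h1 := hcross u v huv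
      have h2 := hcross v u huv.symm
      simp only [huv, true_and]
      omega

lemma nct_split_edge {i c : ℤ} {G : SimpleGraph ℤ} (h : Nct i c G) (hic : i < c)
    (hadj : G.Adj i c) : ∃ s, i ≤ s ∧ s < c ∧ Nct i s (nctR G i s) ∧
      Nct (s + 1) c (nctR G (s + 1) c) ∧
      nctR G i s ⊔ nctR G (s + 1) c ⊔ SimpleGraph.edge i c = G := by
  set H := G.deleteEdges {s(i, c)} with hH
  have hnr : ¬ H.Reachable i c := by
    have := h.acyc
    rw [SimpleGraph.isAcyclic_iff_forall_adj_isBridge] at this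
    have := this hadj
    rwa [SimpleGraph.isBridge_iff] at this
  have hHG : H ≤ G := SimpleGraph.deleteEdges_le _
  have hHadj : ∀ u v, H.Adj u v ↔ G.Adj u v ∧ ¬ ((u = i ∧ v = c) ∨ (u = c ∧ v = i)) := by
    intro u v
    rw [hH, SimpleGraph.deleteEdges_adj]
    simp
  -- every vertex is reachable from i or c in H
  have hor : ∀ u, i ≤ u → u ≤ c → H.Reachable i u ∨ H.Reachable c u := by
    intro u h1 h2
    refine nct_reach_inv (fun x => H.Reachable i x ∨ H.Reachable c x) ?_ (h.conn u h1 h2)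
      (Or.inl (SimpleGraph.Reachable.refl _))
    intro x y hx hxy
    by_cases he : (x = i ∧ y = c) ∨ (x = c ∧ y = i)
    · rcases he with ⟨rfl, rfl⟩ | ⟨rfl, rfl⟩
      · right; exact SimpleGraph.Reachable.refl _
      · left; exact SimpleGraph.Reachable.refl _
    · have : H.Adj x y := (hHadj x y).2 ⟨hxy, he⟩
      exact hx.imp (fun hx => hx.trans this.reachable) (fun hx => hx.trans this.reachable)
  obtain ⟨s, hs, hmax⟩ : ∃ s, (i ≤ s ∧ s ≤ c ∧ H.Reachable i s) ∧
      ∀ x, (i ≤ x ∧ x ≤ c ∧ H.Reachable i x) → x ≤ s := by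
    obtain ⟨s, hs, hmax⟩ := Int.exists_greatest_of_bdd
      (P := fun s => i ≤ s ∧ s ≤ c ∧ H.Reachable i s) ⟨c, fun z hz => hz.2.1⟩
      ⟨i, le_rfl, hic.le, SimpleGraph.Reachable.refl _⟩
    exact ⟨s, hs, hmax⟩
  have hsc : s < c := by
    rcases eq_or_lt_of_le hs.2.1 with h1 | h1
    · exact absurd (h1 ▸ hs.2.2) hnr
    · exact h1
  -- all of [i,s] is reachable from i
  have hlow : ∀ x, i ≤ x → x ≤ s → H.Reachable i x := by
    intro x h1 h2
    by_contra hx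
    have hxc : H.Reachable x c := ((hor x h1 (by omega)).resolve_left hx).symm
    have hxi : i < x := by
      rcases eq_or_lt_of_le h1 with h3 | h3
      · exact absurd (h3 ▸ SimpleGraph.Reachable.refl _) hx
      · exact h3
    have hxs : x < s := by
      rcases eq_or_lt_of_le h2 with h3 | h3
      · exact absurd (h3 ▸ hs.2.2) hx
      · exact h3
    have := nct_reach_inv (fun y => ¬ H.Reachable i y ∧ i < y ∧ y < s) ?_ hxc ⟨hx, hxi, hxs⟩
    · have := this.2.2; omega
    · rintro y z ⟨hy, hiy, hys⟩ hyz
      have hz : ¬ H.Reachable i z := fun hz => hy (hz.trans hyz.symm.reachable)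
      have hzb := h.supp z y (hHG hyz).symm
      have hzi : z ≠ i := fun e => hz (e ▸ SimpleGraph.Reachable.refl _)
      have hzs : z ≠ s := fun e => hz (e ▸ hs.2.2)
      refine ⟨hz, by omega, ?_⟩
      by_contra hlt
      -- edge y z jumps over s
      have := nct_reach_inv (fun w => H.Reachable i w ∧ (w < y ∨ z < w)) ?_ hs.2.2
        ⟨SimpleGraph.Reachable.refl _, Or.inl hiy⟩
      · have := this.2; omega
      · rintro w w' ⟨hw, hwr⟩ hww
        have hw' : H.Reachable i w' := hw.trans hww.reachable
        refine ⟨hw', ?_⟩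
        by_contra hcon
        have n1 : w' ≠ y := fun e => hy (e ▸ hw')
        have n2 : w' ≠ z := fun e => hz (e ▸ hw')
        rcases hwr with hwr | hwr
        · exact h.nc w w' y z (hHG hww) (hHG hyz) (by omega) (by omega) (by omega)
        · exact h.nc y z w' w (hHG hyz) (hHG hww).symm (by omega) (by omega) (by omega)
  have hhigh : ∀ x, s < x → x ≤ c → H.Reachable c x := by
    intro x h1 h2
    refine (hor x (by omega) h2).resolve_left ?_
    intro h3
    have := hmax x ⟨by omega, h2, h3⟩
    omega
  have hsep : ∀ u v, H.Adj u v → u ≤ s → v ≤ s := by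
    intro u v huv hu
    have h1 := h.supp u v (hHG huv)
    have h2 := h.supp v u (hHG huv).symm
    exact hmax v ⟨h2.1, h2.2, (hlow u h1.1 hu).trans huv.reachable⟩
  refine ⟨s, hs.1, hsc, h.restrict ?_, h.restrict ?_, ?_⟩
  · intro u h1 h2
    have : (nctR G i s).Reachable i u ∧ u ≤ s := by
      refine nct_reach_inv (fun y => (nctR G i s).Reachable i y ∧ y ≤ s) ?_ (hlow u h1 h2)
        ⟨SimpleGraph.Reachable.refl _, hs.1⟩
      rintro y z ⟨hy, hys⟩ hyz
      have hzs := hsep y z hyz hys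
      have h1 := h.supp y z (hHG hyz)
      have h2 := h.supp z y (hHG hyz).symm
      exact ⟨hy.trans (SimpleGraph.Adj.reachable ⟨hHG hyz, by omega, by omega⟩), hzs⟩
    exact this.1
  · have hc : ∀ u, s < u → u ≤ c → (nctR G (s + 1) c).Reachable c u := by
      intro u h1 h2
      have : (nctR G (s + 1) c).Reachable c u ∧ s < u := by
        refine nct_reach_inv (fun y => (nctR G (s + 1) c).Reachable c y ∧ s < y) ?_
          (hhigh u h1 h2) ⟨SimpleGraph.Reachable.refl _, hsc⟩
        rintro y z ⟨hy, hys⟩ hyz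
        have hzs : s < z := by
          by_contra hz
          have := hsep z y hyz.symm (by omega)
          omega
        have h1 := h.supp y z (hHG hyz)
        have h2 := h.supp z y (hHG hyz).symm
        exact ⟨hy.trans (SimpleGraph.Adj.reachable ⟨hHG hyz, by omega, by omega⟩), hzs⟩
      exact this.1
    intro u h1 h2
    exact (hc (s + 1) (by omega) (by omega)).symm.trans (hc u (by omega) h2)
  · ext u v
    simp only [SimpleGraph.sup_adj, nctR_adj, nct_edge_adj]
    constructor
    · rintro ((h | h) | ⟨⟨rfl, rfl⟩ | ⟨rfl, rfl⟩, h⟩)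
      · exact h.1
      · exact h.1
      · exact hadj
      · exact hadj.symm
    · intro huv
      have hx := h.supp u v huv
      have hy := h.supp v u huv.symm
      by_cases he : (u = i ∧ v = c) ∨ (u = c ∧ v = i)
      · right; exact ⟨he, huv.ne⟩
      · left
        have hh : H.Adj u v := (hHadj u v).2 ⟨huv, he⟩
        have h1 := hsep u v hh
        have h2 := hsep v u hh.symm
        simp only [huv, true_and]
        omega


/-! ### Part B2 -/
open Filter Set
open scoped Topology

/-- Degree of a vertex, as a cardinality. -/
noncomputable def nctD (G : SimpleGraph ℤ) (v : ℤ) : ℕ := Set.ncard {w | G.Adj v w}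

lemma nctD_congr {G H : SimpleGraph ℤ} {v : ℤ} (h : ∀ w, G.Adj v w ↔ H.Adj v w) :
    nctD G v = nctD H v := by
  unfold nctD
  congr 1
  ext w
  exact h w

lemma Nct.supp' {i j : ℤ} {G : SimpleGraph ℤ} (h : Nct i j G) {u v : ℤ} (huv : G.Adj u v) :
    i ≤ u ∧ u ≤ j ∧ i ≤ v ∧ v ≤ j ∧ u ≠ v :=
  ⟨(h.supp u v huv).1, (h.supp u v huv).2, (h.supp v u huv.symm).1, (h.supp v u huv.symm).2, huv.ne⟩

lemma Nct.finite_nbr {i j : ℤ} {G : SimpleGraph ℤ} (h : Nct i j G) (v : ℤ) :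
    {w | G.Adj v w}.Finite :=
  (Set.finite_Icc i j).subset fun w hw => ⟨(h.supp' hw).2.2.1, (h.supp' hw).2.2.2.1⟩

lemma Nct.deg_le {i j : ℤ} {G : SimpleGraph ℤ} (h : Nct i j G) (v : ℤ) (h1 : i ≤ v) (h2 : v ≤ j) :
    nctD G v ≤ (j - i).toNat := by
  unfold nctD
  have hs : {w | G.Adj v w} ⊆ ((Finset.Icc i j).erase v : Set ℤ) := by
    intro w hw
    have := h.supp' hw
    simp
    omega
  have := Set.ncard_le_ncard hs (Finset.finite_toSet _)
  rw [Set.ncard_coe_finset, Finset.card_erase_of_mem (by simp; omega)] at this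
  simp at this
  omega

/-- The join of three trees with the edge `i c`. -/
def nctJ (i c : ℤ) (L M R : SimpleGraph ℤ) : SimpleGraph ℤ := L ⊔ M ⊔ SimpleGraph.edge i c ⊔ R

lemma nctJ_adj {i c u v : ℤ} {L M R : SimpleGraph ℤ} : (nctJ i c L M R).Adj u v ↔
    L.Adj u v ∨ M.Adj u v ∨ (((u = i ∧ v = c) ∨ (u = c ∧ v = i)) ∧ u ≠ v) ∨ R.Adj u v := by
  simp only [nctJ, SimpleGraph.sup_adj, nct_edge_adj, or_assoc]

section
variable {i s c j : ℤ} {L M R : SimpleGraph ℤ}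

lemma nctJ_nct (his : i ≤ s) (hsc : s < c) (hcj : c ≤ j) (hL : Nct i s L)
    (hM : Nct (s + 1) c M) (hR : Nct c j R) : Nct i j (nctJ i c L M R) :=
  nct_glue (by omega) hcj (nct_join his hsc hL hM) hR

lemma nctJ_D_left (hsc : s < c) (hM : Nct (s + 1) c M) (hR : Nct c j R)
    {v : ℤ} (h1 : i < v) (h2 : v ≤ s) : nctD (nctJ i c L M R) v = nctD L v := by
  apply nctD_congr
  intro w
  rw [nctJ_adj]
  refine ⟨?_, Or.inl⟩
  rintro (h | h | h | h)
  · exact h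
  · have := hM.supp' h; omega
  · omega
  · have := hR.supp' h; omega

lemma nctJ_D_mid (his : i ≤ s) (hL : Nct i s L) (hR : Nct c j R)
    {v : ℤ} (h1 : s < v) (h2 : v < c) : nctD (nctJ i c L M R) v = nctD M v := by
  apply nctD_congr
  intro w
  rw [nctJ_adj]
  refine ⟨?_, fun h => Or.inr (Or.inl h)⟩
  rintro (h | h | h | h)
  · have := hL.supp' h; omega
  · exact h
  · omega
  · have := hR.supp' h; omega

lemma nctJ_D_right (his : i ≤ s) (hsc : s < c) (hL : Nct i s L) (hM : Nct (s + 1) c M)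
    {v : ℤ} (h1 : c < v) : nctD (nctJ i c L M R) v = nctD R v := by
  apply nctD_congr
  intro w
  rw [nctJ_adj]
  refine ⟨?_, fun h => Or.inr (Or.inr (Or.inr h))⟩
  rintro (h | h | h | h)
  · have := hL.supp' h; omega
  · have := hM.supp' h; omega
  · omega
  · exact h

lemma nctJ_D_root (his : i ≤ s) (hsc : s < c) (hL : Nct i s L)
    (hM : Nct (s + 1) c M) (hR : Nct c j R) : nctD (nctJ i c L M R) i = nctD L i + 1 := by
  unfold nctD
  rw [← Set.ncard_insert_of_notMem (a := c) _ (hL.finite_nbr i)]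
  · congr 1
    ext w
    simp only [Set.mem_ofPred_eq, nctJ_adj, Set.mem_insert_iff]
    constructor
    · rintro (h | h | h | h)
      · exact Or.inr h
      · have := hM.supp' h; omega
      · left; omega
      · have := hR.supp' h; omega
    · rintro (h | h)
      · right; right; left; exact ⟨Or.inl ⟨trivial, h⟩, by omega⟩
      · exact Or.inl h
  · intro h
    have := hL.supp' h
    omega

lemma nctJ_D_c (his : i ≤ s) (hsc : s < c) (hL : Nct i s L)
    (hM : Nct (s + 1) c M) (hR : Nct c j R) :
    nctD (nctJ i c L M R) c = nctD M c + nctD R c + 1 := by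
  unfold nctD
  rw [← Set.ncard_union_eq _ (hM.finite_nbr c) (hR.finite_nbr c),
    ← Set.ncard_insert_of_notMem (a := i) _ ((hM.finite_nbr c).union (hR.finite_nbr c))]
  · congr 1
    ext w
    simp only [Set.mem_ofPred_eq, nctJ_adj, Set.mem_insert_iff, Set.mem_union]
    constructor
    · rintro (h | h | h | h)
      · have := hL.supp' h; omega
      · exact Or.inr (Or.inl h)
      · left; omega
      · exact Or.inr (Or.inr h)
    · rintro (h | h | h)
      · right; right; left; exact ⟨Or.inr ⟨trivial, h⟩, by omega⟩
      · exact Or.inr (Or.inl h)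
      · exact Or.inr (Or.inr (Or.inr h))
  · rintro (h | h)
    · have := hM.supp' h; omega
    · have := hR.supp' h; omega
  · rw [Set.disjoint_left]
    intro w h h'
    have := hM.supp' h; have := hR.supp' h'; omega

lemma nctJ_L (hsc : s < c) (hL : Nct i s L)
    (hM : Nct (s + 1) c M) (hR : Nct c j R) : nctR (nctJ i c L M R) i s = L := by
  ext u v
  rw [nctR_adj, nctJ_adj]
  constructor
  · rintro ⟨h | h | h | h, h1⟩
    · exact h
    · have := hM.supp' h; omega
    · omega
    · have := hR.supp' h; omega
  · intro h
    have := hL.supp' h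
    exact ⟨Or.inl h, by omega⟩

lemma nctJ_M (his : i ≤ s) (hL : Nct i s L)
    (hM : Nct (s + 1) c M) (hR : Nct c j R) : nctR (nctJ i c L M R) (s + 1) c = M := by
  ext u v
  rw [nctR_adj, nctJ_adj]
  constructor
  · rintro ⟨h | h | h | h, h1⟩
    · have := hL.supp' h; omega
    · exact h
    · omega
    · have := hR.supp' h; omega
  · intro h
    have := hM.supp' h
    exact ⟨Or.inr (Or.inl h), by omega⟩

lemma nctJ_R (his : i ≤ s) (hsc : s < c) (hL : Nct i s L)
    (hM : Nct (s + 1) c M) (hR : Nct c j R) : nctR (nctJ i c L M R) c j = R := by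
  ext u v
  rw [nctR_adj, nctJ_adj]
  constructor
  · rintro ⟨h | h | h | h, h1⟩
    · have := hL.supp' h; omega
    · have := hM.supp' h; omega
    · omega
    · exact h
  · intro h
    have := hR.supp' h
    exact ⟨Or.inr (Or.inr (Or.inr h)), by omega⟩

lemma nctJ_c_le {s' c' : ℤ} {L' M' R' : SimpleGraph ℤ} (his : i ≤ s) (hsc : s < c)
    (his' : i ≤ s') (hsc' : s' < c')
    (hL' : Nct i s' L') (hM' : Nct (s' + 1) c' M') (hR' : Nct c' j R')
    (h : nctJ i c L M R = nctJ i c' L' M' R') : c ≤ c' := by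
  have h1 : (nctJ i c L M R).Adj i c := by
    rw [nctJ_adj]; right; right; left; omega
  rw [h, nctJ_adj] at h1
  rcases h1 with h | h | h | h
  · have := hL'.supp' h; omega
  · have := hM'.supp' h; omega
  · omega
  · have := hR'.supp' h; omega

lemma nctJ_s_le {s' : ℤ} {L' M' R' : SimpleGraph ℤ} (his : i ≤ s)
    (hsc' : s' < c) (hL : Nct i s L) (hM : Nct (s + 1) c M) (hR : Nct c j R)
    (hL' : Nct i s' L') (h : nctJ i c L M R = nctJ i c L' M' R') : s' ≤ s := by
  by_contra hlt
  have := nct_reach_inv (fun x => x ≤ s) ?_ (hL'.conn (s + 1) (by omega) (by omega)) his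
  · omega
  · intro u v hu huv
    have hb := hL'.supp' huv
    have h1 : (nctJ i c L' M' R').Adj u v := by
      rw [nctJ_adj]; left; exact huv
    rw [← h, nctJ_adj] at h1
    rcases h1 with h | h | h | h
    · exact (hL.supp' h).2.2.2.1
    · have := hM.supp' h; omega
    · omega
    · have := hR.supp' h; omega

end

lemma nct_exists_join {i j : ℤ} {G : SimpleGraph ℤ} (h : Nct i j G) (hij : i < j) :
    ∃ s c L M R, i ≤ s ∧ s < c ∧ c ≤ j ∧ Nct i s L ∧ Nct (s + 1) c M ∧ Nct c j R ∧
      nctJ i c L M R = G := by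
  -- i has a neighbour
  have hex : ∃ v, G.Adj i v := by
    by_contra hno
    push Not at hno
    have := nct_reach_inv (fun x => x = i) ?_ (h.conn j hij.le le_rfl) rfl
    · omega
    · rintro u v rfl huv
      exact absurd huv (hno v)
  obtain ⟨c, hc, hmax⟩ := Int.exists_greatest_of_bdd
      (P := fun v => G.Adj i v) ⟨j, fun z hz => (h.supp' hz).2.2.2.1⟩ hex
  have hb := h.supp' hc
  have hic : i < c := by omega
  obtain ⟨hP, hR, hPR⟩ := nct_split_right h hic hc hmax
  have hadj : (nctR G i c).Adj i c := ⟨hc, by omega, by omega⟩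
  obtain ⟨s, h1, h2, hL, hM, hLM⟩ := nct_split_edge hP hic hadj
  exact ⟨s, c, _, _, _, h1, h2, by omega, hL, hM, hR, by rw [nctJ, hLM, hPR]⟩

/-- Noncrossing trees on `[i,j]` with root degree `k` at the left end, other degrees in `A`. -/
def nctX (A : Set ℕ) (k : ℕ) (i j : ℤ) : Set (SimpleGraph ℤ) :=
  {G | Nct i j G ∧ nctD G i = k ∧ ∀ v, i < v → v ≤ j → nctD G v ∈ A}

/-- Noncrossing trees on `[i,j]` with root degree `k` at the right end, other degrees in `A`. -/
def nctY (A : Set ℕ) (k : ℕ) (i j : ℤ) : Set (SimpleGraph ℤ) :=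
  {G | Nct i j G ∧ nctD G j = k ∧ ∀ v, i ≤ v → v < j → nctD G v ∈ A}

lemma nct_finite (i j : ℤ) : {G | Nct i j G}.Finite := by
  have hinj : Function.Injective (fun G : SimpleGraph ℤ => {p : ℤ × ℤ | G.Adj p.1 p.2}) := by
    intro G H h
    ext u v
    have := Set.ext_iff.1 h (u, v)
    simpa using this
  apply Set.Finite.of_finite_image (f := fun G : SimpleGraph ℤ => {p : ℤ × ℤ | G.Adj p.1 p.2})
    _ hinj.injOn
  apply (((Set.finite_Icc i j).prod (Set.finite_Icc i j)).powerset).subset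
  rintro _ ⟨G, hG, rfl⟩
  rw [Set.mem_powerset_iff]
  rintro ⟨u, v⟩ huv
  have := Nct.supp' hG huv
  exact ⟨⟨this.1, this.2.1⟩, this.2.2.1, this.2.2.2.1⟩

lemma nctX_finite (A : Set ℕ) (k : ℕ) (i j : ℤ) : (nctX A k i j).Finite :=
  (nct_finite i j).subset fun _ h => h.1

lemma nctY_finite (A : Set ℕ) (k : ℕ) (i j : ℤ) : (nctY A k i j).Finite :=
  (nct_finite i j).subset fun _ h => h.1

open Classical in
lemma nctX_card_rec (A : Set ℕ) (k : ℕ) (i j : ℤ) (N : ℕ) (hN : (j - i).toNat < N) :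
    (nctX A (k + 1) i j).ncard = ∑ p ∈ (((Finset.Icc i j ×ˢ Finset.Icc i j) ×ˢ
      (Finset.range N ×ˢ Finset.range N)).filter
        fun p => p.1.1 < p.1.2 ∧ p.2.1 + p.2.2 + 1 ∈ A),
      (nctX A k i p.1.1).ncard * ((nctY A p.2.1 (p.1.1 + 1) p.1.2).ncard *
        (nctX A p.2.2 p.1.2 j).ncard) := by
  have hX : ∀ k i j, (nctX A k i j).ncard = (nctX_finite A k i j).toFinset.card :=
    fun k i j => Set.ncard_eq_toFinset_card _ _
  have hY : ∀ k i j, (nctY A k i j).ncard = (nctY_finite A k i j).toFinset.card :=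
    fun k i j => Set.ncard_eq_toFinset_card _ _
  simp only [hX, hY]
  simp only [← Finset.card_product]
  rw [← Finset.card_sigma]
  symm
  apply Finset.card_bij (fun (q : (_ : (ℤ × ℤ) × (ℕ × ℕ)) × _) _ =>
    nctJ i q.1.1.2 q.2.1 q.2.2.1 q.2.2.2)
  · rintro ⟨⟨⟨s, c⟩, ⟨l, r⟩⟩, ⟨L, M, R⟩⟩ hq
    simp only [Finset.mem_sigma, Finset.mem_filter, Finset.mem_product, Finset.mem_Icc,
      Finset.mem_range, Set.Finite.mem_toFinset, nctX, nctY, Set.mem_ofPred_eq] at hq ⊢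
    obtain ⟨⟨⟨⟨hs, hc⟩, -⟩, hsc, hA⟩, ⟨hL, hLk, hLA⟩, ⟨hM, hMl, hMA⟩, ⟨hR, hRr, hRA⟩⟩ := hq
    refine ⟨nctJ_nct hs.1 hsc hc.2 hL hM hR, ?_, ?_⟩
    · rw [nctJ_D_root hs.1 hsc hL hM hR, hLk]
    · intro v h1 h2
      rcases le_or_gt v s with h3 | h3
      · rw [nctJ_D_left hsc hM hR h1 h3]; exact hLA v h1 h3
      · rcases lt_trichotomy v c with h4 | h4 | h4
        · rw [nctJ_D_mid hs.1 hL hR h3 h4]; exact hMA v (by omega) h4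
        · subst h4
          rw [nctJ_D_c hs.1 hsc hL hM hR, hMl, hRr]; exact hA
        · rw [nctJ_D_right hs.1 hsc hL hM h4]; exact hRA v h4 h2
  · rintro ⟨⟨⟨s, c⟩, ⟨l, r⟩⟩, ⟨L, M, R⟩⟩ hq ⟨⟨⟨s', c'⟩, ⟨l', r'⟩⟩, ⟨L', M', R'⟩⟩ hq' heq
    simp only [Finset.mem_sigma, Finset.mem_filter, Finset.mem_product, Finset.mem_Icc,
      Finset.mem_range, Set.Finite.mem_toFinset, nctX, nctY, Set.mem_ofPred_eq] at hq hq' heq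
    obtain ⟨⟨⟨⟨hs, hc⟩, -⟩, hsc, hA⟩, ⟨hL, hLk, hLA⟩, ⟨hM, hMl, hMA⟩, ⟨hR, hRr, hRA⟩⟩ := hq
    obtain ⟨⟨⟨⟨hs', hc'⟩, -⟩, hsc', hA'⟩, ⟨hL', hLk', hLA'⟩, ⟨hM', hMl', hMA'⟩,
      ⟨hR', hRr', hRA'⟩⟩ := hq'
    have e1 : c = c' := le_antisymm (nctJ_c_le hs.1 hsc hs'.1 hsc' hL' hM' hR' heq)
      (nctJ_c_le hs'.1 hsc' hs.1 hsc hL hM hR heq.symm)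
    subst e1
    have e2 : s = s' := le_antisymm (nctJ_s_le hs'.1 hsc hL' hM' hR' hL heq.symm)
      (nctJ_s_le hs.1 hsc' hL hM hR hL' heq)
    subst e2
    have e3 : L = L' := by
      rw [← nctJ_L hsc hL hM hR, heq, nctJ_L hsc hL' hM' hR']
    have e4 : M = M' := by
      rw [← nctJ_M hs.1 hL hM hR, heq, nctJ_M hs.1 hL' hM' hR']
    have e5 : R = R' := by
      rw [← nctJ_R hs.1 hsc hL hM hR, heq, nctJ_R hs.1 hsc hL' hM' hR']
    subst e3 e4 e5
    subst hMl hMl' hRr hRr'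
    rfl
  · intro G hG
    simp only [Set.Finite.mem_toFinset, nctX, Set.mem_ofPred_eq] at hG
    obtain ⟨hG, hk, hGA⟩ := hG
    have hij : i < j := by
      have : {w | G.Adj i w}.Nonempty := by
        rw [← Set.ncard_pos (hG.finite_nbr i)]
        unfold nctD at hk
        omega
      obtain ⟨w, hw⟩ := this
      have := hG.supp' hw
      omega
    obtain ⟨s, c, L, M, R, his, hsc, hcj, hL, hM, hR, rfl⟩ := nct_exists_join hG hij
    refine ⟨⟨⟨⟨s, c⟩, ⟨nctD M c, nctD R c⟩⟩, ⟨L, M, R⟩⟩, ?_, rfl⟩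
    simp only [Finset.mem_sigma, Finset.mem_filter, Finset.mem_product, Finset.mem_Icc,
      Finset.mem_range, Set.Finite.mem_toFinset, nctX, nctY, Set.mem_ofPred_eq]
    have d1 := hM.deg_le c (by omega) le_rfl
    have d2 := hR.deg_le c le_rfl hcj
    refine ⟨⟨⟨⟨⟨his, by omega⟩, by omega, hcj⟩, by omega, by omega⟩, hsc, ?_⟩, ⟨hL, ?_, ?_⟩,
      ⟨hM, trivial, ?_⟩, ⟨hR, trivial, ?_⟩⟩
    · rw [← nctJ_D_c his hsc hL hM hR]
      exact hGA c (by omega) hcj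
    · rw [nctJ_D_root his hsc hL hM hR] at hk
      omega
    · intro v h1 h2
      rw [← nctJ_D_left (L := L) hsc hM hR h1 h2]
      exact hGA v h1 (by omega)
    · intro v h1 h2
      rw [← nctJ_D_mid (M := M) his hL hR (by omega) h2]
      exact hGA v (by omega) (by omega)
    · intro v h1 h2
      rw [← nctJ_D_right (R := R) his hsc hL hM h1]
      exact hGA v (by omega) (by omega)

lemma nctX_zero (A : Set ℕ) (i j : ℤ) (hij : i ≤ j) :
    (nctX A 0 i j).ncard = if i = j then 1 else 0 := by
  split_ifs with h
  · subst h
    rw [Set.ncard_eq_one]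
    refine ⟨⊥, ?_⟩
    ext G
    simp only [nctX, Set.mem_ofPred_eq, Set.mem_singleton_iff, nct_single]
    constructor
    · exact fun h => h.1
    · rintro rfl
      refine ⟨rfl, ?_, ?_⟩
      · simp [nctD]
      · intro v h1 h2; omega
  · rw [Set.ncard_eq_zero (nctX_finite _ _ _ _)]
    ext G
    simp only [nctX, Set.mem_ofPred_eq, Set.mem_empty_iff_false, iff_false]
    rintro ⟨hG, hk, -⟩
    obtain ⟨s, c, L, M, R, his, hsc, hcj, hL, hM, hR, rfl⟩ := nct_exists_join hG (by omega)
    rw [nctJ_D_root his hsc hL hM hR] at hk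
    omega

lemma nctX_card_zero_of_lt (A : Set ℕ) (k : ℕ) (i j : ℤ) (hij : i ≤ j) (h : (j - i).toNat < k) :
    (nctX A k i j).ncard = 0 := by
  rw [Set.ncard_eq_zero (nctX_finite _ _ _ _)]
  ext G
  simp only [nctX, Set.mem_ofPred_eq, Set.mem_empty_iff_false, iff_false]
  rintro ⟨hG, hk, -⟩
  have := hG.deg_le i le_rfl hij
  omega

/-! Symmetries -/

lemma nctD_comap (e : ℤ ≃ ℤ) (G : SimpleGraph ℤ) (v : ℤ) :
    nctD (G.comap e) v = nctD G (e v) := by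
  unfold nctD
  simp only [SimpleGraph.comap_adj]
  exact Set.ncard_preimage_of_injective_subset_range (s := {w | G.Adj (e v) w}) e.injective
    (by simp)

lemma nct_comap_shift (t i j : ℤ) (G : SimpleGraph ℤ) (h : Nct i j G) :
    Nct (i - t) (j - t) (G.comap (Equiv.addRight t)) where
  supp := by
    intro u v huv
    have := h.supp' huv
    simp at this
    omega
  nc := by
    intro a b c d h1 h2 h3 h4 h5
    exact h.nc _ _ _ _ h1 h2 (by simpa) (by simpa) (by simpa)
  acyc := h.acyc.of_comap (Equiv.addRight t).toEmbedding
  conn := by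
    intro u h1 h2
    have := nct_reach_map (H := G.comap (Equiv.addRight t)) (fun x => x - t) ?_
      (h.conn (u + t) (by omega) (by omega))
    · simpa using this
    · intro x y hxy
      apply SimpleGraph.Adj.reachable
      simpa using hxy

lemma nctX_shift_sub (A : Set ℕ) (k : ℕ) (t i j : ℤ) {G : SimpleGraph ℤ} (h : G ∈ nctX A k i j) :
    G.comap (Equiv.addRight t) ∈ nctX A k (i - t) (j - t) := by
  obtain ⟨h1, h2, h3⟩ := h
  refine ⟨nct_comap_shift t i j G h1, ?_, ?_⟩
  · rw [nctD_comap]; simpa using h2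
  · intro v hv hv'
    rw [nctD_comap]
    simp only [Equiv.coe_addRight]
    exact h3 _ (by omega) (by omega)

lemma nct_comap_inj (e : ℤ ≃ ℤ) : Function.Injective (fun G : SimpleGraph ℤ => G.comap e) := by
  intro G H h
  ext u v
  have : (G.comap e).Adj (e.symm u) (e.symm v) ↔ (H.comap e).Adj (e.symm u) (e.symm v) := by
    simp only at h
    rw [h]
  simpa using this

lemma nctX_shift (A : Set ℕ) (k : ℕ) (i j t : ℤ) :
    (nctX A k (i - t) (j - t)).ncard = (nctX A k i j).ncard := by
  have key : ∀ t i j : ℤ, (nctX A k i j).ncard ≤ (nctX A k (i - t) (j - t)).ncard := by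
    intro t i j
    exact Set.ncard_le_ncard_of_injOn _ (fun G hG => nctX_shift_sub A k t i j hG)
      (nct_comap_inj _).injOn (nctX_finite _ _ _ _)
  apply le_antisymm
  · have := key (-t) (i - t) (j - t)
    simpa using this
  · exact key t i j

lemma nct_comap_neg (i j : ℤ) (hij : i ≤ j) (G : SimpleGraph ℤ) (h : Nct i j G) :
    Nct (-j) (-i) (G.comap (Equiv.neg ℤ)) where
  supp := by
    intro u v huv
    have := h.supp' huv
    simp at this
    omega
  nc := by
    intro a b c d h1 h2 h3 h4 h5
    exact h.nc _ _ _ _ h2.symm h1.symm (by simpa) (by simpa) (by simpa)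
  acyc := h.acyc.of_comap (Equiv.neg ℤ).toEmbedding
  conn := by
    intro u h1 h2
    have := nct_reach_map (H := G.comap (Equiv.neg ℤ)) (fun x => - x) ?_
      ((h.conn j hij le_rfl).symm.trans (h.conn (-u) (by omega) (by omega)))
    · simpa using this
    · intro x y hxy
      apply SimpleGraph.Adj.reachable
      simpa using hxy

lemma nctY_eq (A : Set ℕ) (k : ℕ) (i j : ℤ) (hij : i ≤ j) :
    (nctY A k i j).ncard = (nctX A k (-j) (-i)).ncard := by
  apply le_antisymm
  · apply Set.ncard_le_ncard_of_injOn (fun G => G.comap (Equiv.neg ℤ)) _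
      (nct_comap_inj _).injOn (nctX_finite _ _ _ _)
    rintro G ⟨h1, h2, h3⟩
    refine ⟨nct_comap_neg i j hij G h1, ?_, ?_⟩
    · rw [nctD_comap]; simpa using h2
    · intro v hv hv'
      rw [nctD_comap]
      simp only [Equiv.neg_apply]
      exact h3 _ (by omega) (by omega)
  · apply Set.ncard_le_ncard_of_injOn (fun G => G.comap (Equiv.neg ℤ)) _
      (nct_comap_inj _).injOn (nctY_finite _ _ _ _)
    rintro G ⟨h1, h2, h3⟩
    refine ⟨?_, ?_, ?_⟩
    · simpa using nct_comap_neg (-j) (-i) (by omega) G h1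
    · rw [nctD_comap]; simpa using h2
    · intro v hv hv'
      rw [nctD_comap]
      simp only [Equiv.neg_apply]
      exact h3 _ (by omega) (by omega)

/-- The number of trees with root degree `k` and `m` other vertices. -/
noncomputable def nctF (A : Set ℕ) (k m : ℕ) : ℕ := (nctX A k 0 m).ncard

lemma nctX_eq_F (A : Set ℕ) (k : ℕ) (i j : ℤ) (hij : i ≤ j) :
    (nctX A k i j).ncard = nctF A k (j - i).toNat := by
  unfold nctF
  rw [← nctX_shift A k i j i]
  congr 2
  · ring
  · omega

lemma nctY_eq_F (A : Set ℕ) (k : ℕ) (i j : ℤ) (hij : i ≤ j) :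
    (nctY A k i j).ncard = nctF A k (j - i).toNat := by
  rw [nctY_eq A k i j hij, nctX_eq_F A k _ _ (by omega)]
  congr 2
  ring


/-! ### Part B3 -/
open Filter Set
open scoped Topology

lemma nct_sum_reindex (m : ℕ) (g : ℕ → ℕ → ℕ → ℝ) :
    ∑ p ∈ (Finset.Icc (0 : ℤ) ((m + 1 : ℕ) : ℤ) ×ˢ Finset.Icc (0 : ℤ) ((m + 1 : ℕ) : ℤ)).filter
      (fun p => p.1 < p.2),
      g (p.1 - 0).toNat (p.2 - (p.1 + 1)).toNat (((m + 1 : ℕ) : ℤ) - p.2).toNat =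
    ∑ p ∈ Finset.HasAntidiagonal.antidiagonal m, ∑ q ∈ Finset.HasAntidiagonal.antidiagonal p.2, g p.1 q.1 q.2 := by
  rw [Finset.sum_sigma']
  refine Finset.sum_bij' (fun p _ => ⟨((p.1).toNat, m - (p.1).toNat),
      ((p.2 - (p.1 + 1)).toNat, (((m + 1 : ℕ) : ℤ) - p.2).toNat)⟩)
    (fun p _ => ((p.1.1 : ℤ), (p.1.1 : ℤ) + 1 + p.2.1)) ?_ ?_ ?_ ?_ ?_
  · rintro ⟨s, c⟩ h
    simp only [Finset.mem_filter, Finset.mem_product, Finset.mem_Icc, Finset.mem_sigma,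
      Finset.HasAntidiagonal.mem_antidiagonal] at h ⊢
    omega
  · rintro ⟨⟨a, a'⟩, ⟨x, y⟩⟩ h
    simp only [Finset.mem_filter, Finset.mem_product, Finset.mem_Icc, Finset.mem_sigma,
      Finset.HasAntidiagonal.mem_antidiagonal] at h ⊢
    omega
  · rintro ⟨s, c⟩ h
    simp only [Finset.mem_filter, Finset.mem_product, Finset.mem_Icc] at h ⊢
    ext <;> simp <;> omega
  · rintro ⟨⟨a, a'⟩, ⟨x, y⟩⟩ h
    simp only [Finset.mem_sigma, Finset.HasAntidiagonal.mem_antidiagonal] at h ⊢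
    obtain ⟨h1, h2⟩ := h
    have e1 : ((a : ℤ)).toNat = a := by omega
    have e2 : m - a = a' := by omega
    have e3 : ((a : ℤ) + 1 + x - (a + 1)).toNat = x := by omega
    have e4 : (((m + 1 : ℕ) : ℤ) - ((a : ℤ) + 1 + x)).toNat = y := by omega
    simp only [e1, e2, e3, e4]
  · rintro ⟨s, c⟩ h
    simp

open Classical in
/-- offspring weights -/
noncomputable def nctW (A : Set ℕ) : PowerSeries ℝ :=
  PowerSeries.mk fun k => if k + 1 ∈ A then (k : ℝ) + 1 else 0

noncomputable def nctS (A : Set ℕ) (k : ℕ) : PowerSeries ℝ :=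
  PowerSeries.mk fun m => (nctF A k m : ℝ)

lemma nctF_zero (A : Set ℕ) (m : ℕ) : nctF A 0 m = if m = 0 then 1 else 0 := by
  unfold nctF
  rw [nctX_zero A 0 m (by omega)]
  congr 1
  simp [eq_comm]

lemma nctF_lt (A : Set ℕ) (k m : ℕ) (h : m < k) : nctF A k m = 0 := by
  unfold nctF
  rw [nctX_card_zero_of_lt A k 0 m (by omega)]
  omega

open Classical in
lemma nctF_rec (A : Set ℕ) (k m N : ℕ) (hN : m + 1 < N) :
    (nctF A (k + 1) (m + 1) : ℝ) = ∑ q ∈ (Finset.range N ×ˢ Finset.range N).filter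
      (fun q => q.1 + q.2 + 1 ∈ A),
      PowerSeries.coeff m (nctS A k * (nctS A q.1 * nctS A q.2)) := by
  have h := nctX_card_rec A k 0 ((m + 1 : ℕ) : ℤ) N (by omega)
  rw [nctF, h]
  have e := nct_sum_reindex m (fun s x y => ∑ q ∈ (Finset.range N ×ˢ Finset.range N).filter
      (fun q => q.1 + q.2 + 1 ∈ A), (nctF A k s : ℝ) * ((nctF A q.1 x : ℝ) * nctF A q.2 y))
  have hfil : (((Finset.Icc (0 : ℤ) ((m + 1 : ℕ) : ℤ) ×ˢ Finset.Icc (0 : ℤ) ((m + 1 : ℕ) : ℤ)) ×ˢ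
      (Finset.range N ×ˢ Finset.range N)).filter
        fun p => p.1.1 < p.1.2 ∧ p.2.1 + p.2.2 + 1 ∈ A) =
      ((Finset.Icc (0 : ℤ) ((m + 1 : ℕ) : ℤ) ×ˢ Finset.Icc (0 : ℤ) ((m + 1 : ℕ) : ℤ)).filter
      (fun p => p.1 < p.2)) ×ˢ ((Finset.range N ×ˢ Finset.range N).filter
      (fun q => q.1 + q.2 + 1 ∈ A)) := by
    ext p
    simp only [Finset.mem_filter, Finset.mem_product]
    tauto
  rw [hfil, Finset.sum_product]
  rw [Nat.cast_sum]
  refine Eq.trans (Finset.sum_congr rfl ?_) (e.trans ?_)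
  · rintro ⟨s, c⟩ hp
    rw [Nat.cast_sum]
    apply Finset.sum_congr rfl
    rintro ⟨l, r⟩ hq
    simp only [Finset.mem_filter, Finset.mem_product, Finset.mem_Icc] at hp
    dsimp only
    rw [nctX_eq_F _ _ _ _ (by omega), nctX_eq_F _ _ _ _ (by omega),
      nctY_eq_F _ _ _ _ (by omega)]
    push_cast
    rfl
  · symm
    simp only [PowerSeries.coeff_mul, nctS, PowerSeries.coeff_mk]
    rw [Finset.sum_comm]
    apply Finset.sum_congr rfl
    intro p _
    simp only [Finset.mul_sum]
    rw [Finset.sum_comm]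

open Classical in
/-- The (truncation independent) series of pairs. -/
lemma nctS_succ (A : Set ℕ) : ∃ P : PowerSeries ℝ, (∀ k, nctS A k = (PowerSeries.X * P) ^ k) ∧
    ∀ m N, m < N → PowerSeries.coeff m P = ∑ j ∈ Finset.range N,
      PowerSeries.coeff j (nctW A) * PowerSeries.coeff m (nctS A j) := by
  have h0 : nctS A 0 = 1 := by
    ext m
    rw [nctS, PowerSeries.coeff_mk, nctF_zero, PowerSeries.coeff_one]
    split_ifs <;> simp
  -- the pair series
  let P : PowerSeries ℝ := PowerSeries.mk fun m => (nctF A 1 (m + 1) : ℝ)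
  have hsmall : ∀ k, nctS A (k + 1) = PowerSeries.X * P * nctS A k := by
    intro k
    ext m
    rcases m with _ | m
    · rw [mul_assoc, PowerSeries.coeff_zero_X_mul, nctS, PowerSeries.coeff_mk,
        nctF_lt _ _ _ (by omega)]
      simp
    · rw [mul_assoc, PowerSeries.coeff_succ_X_mul, nctS, PowerSeries.coeff_mk]
      rw [nctF_rec A k m (m + 2) (by omega), mul_comm, PowerSeries.coeff_mul]
      simp only [PowerSeries.coeff_mul _ (nctS A k)]
      rw [Finset.sum_comm]
      apply Finset.sum_congr rfl
      rintro ⟨a, c⟩ hac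
      rw [Finset.HasAntidiagonal.mem_antidiagonal] at hac
      simp only at hac ⊢
      rw [← Finset.mul_sum]
      congr 1
      rw [PowerSeries.coeff_mk]
      have := nctF_rec A 0 c (m + 2) (by omega)
      rw [h0] at this
      simp only [one_mul] at this
      rw [← this]
  have hpow : ∀ k, nctS A k = (PowerSeries.X * P) ^ k := by
    intro k
    induction k with
    | zero => rw [h0, pow_zero]
    | succ k ih => rw [hsmall, ih, pow_succ, mul_comm]
  refine ⟨P, hpow, ?_⟩
  intro m N hN
  have h1 : PowerSeries.coeff m P = ∑ q ∈ (Finset.range (m + 2) ×ˢ Finset.range (m + 2)).filter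
      (fun q => q.1 + q.2 + 1 ∈ A), PowerSeries.coeff m (nctS A (q.1 + q.2)) := by
    rw [PowerSeries.coeff_mk]
    have := nctF_rec A 0 m (m + 2) (by omega)
    rw [h0] at this
    simp only [one_mul] at this
    rw [this]
    apply Finset.sum_congr rfl
    intro q _
    rw [hpow, hpow, hpow, pow_add]
  have hz : ∀ j, m < j → PowerSeries.coeff m (nctS A j) = 0 := by
    intro j hj
    rw [nctS, PowerSeries.coeff_mk, nctF_lt _ _ _ hj, Nat.cast_zero]
  have h2 : ∑ j ∈ Finset.range N,
      PowerSeries.coeff j (nctW A) * PowerSeries.coeff m (nctS A j) =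
      ∑ j ∈ Finset.range (m + 1),
      PowerSeries.coeff j (nctW A) * PowerSeries.coeff m (nctS A j) := by
    symm
    apply Finset.sum_subset
    · intro x; simp only [Finset.mem_range]; omega
    · intro x _ hx
      rw [hz x (by simpa using hx), mul_zero]
  rw [h1, h2]
  have h3 : ∀ j ∈ Finset.range (m + 1),
      PowerSeries.coeff j (nctW A) * PowerSeries.coeff m (nctS A j) =
      ∑ q ∈ Finset.HasAntidiagonal.antidiagonal j,
        if q.1 + q.2 + 1 ∈ A then PowerSeries.coeff m (nctS A (q.1 + q.2)) else 0 := by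
    intro j _
    rw [Finset.sum_congr rfl (g := fun _ => if j + 1 ∈ A then PowerSeries.coeff m (nctS A j)
      else 0)]
    · rw [Finset.sum_const, Finset.Nat.card_antidiagonal, nctW, PowerSeries.coeff_mk]
      split_ifs <;> simp
    · intro q hq
      rw [Finset.HasAntidiagonal.mem_antidiagonal] at hq
      rw [hq]
  rw [Finset.sum_congr rfl h3, Finset.sum_sigma', Finset.sum_filter]
  symm
  rw [← Finset.sum_subset (s₁ := (Finset.range (m + 2) ×ˢ Finset.range (m + 2)).filter
    (fun q => q.1 + q.2 ≤ m)) (Finset.filter_subset _ _)]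
  · refine Finset.sum_bij' (fun p _ => p.2) (fun q _ => ⟨q.1 + q.2, q⟩) ?_ ?_ ?_ ?_ ?_
    · rintro ⟨j, a, c⟩ h
      simp only [Finset.mem_sigma, Finset.mem_range, Finset.HasAntidiagonal.mem_antidiagonal,
        Finset.mem_filter, Finset.mem_product] at h ⊢
      omega
    · rintro ⟨a, c⟩ h
      simp only [Finset.mem_sigma, Finset.mem_range, Finset.HasAntidiagonal.mem_antidiagonal,
        Finset.mem_filter, Finset.mem_product] at h ⊢
      exact ⟨by omega, trivial⟩
    · rintro ⟨j, a, c⟩ h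
      simp only [Finset.mem_sigma, Finset.mem_range, Finset.HasAntidiagonal.mem_antidiagonal] at h ⊢
      obtain ⟨_, rfl⟩ := h
      rfl
    · rintro ⟨a, c⟩ h
      rfl
    · rintro ⟨j, a, c⟩ h
      rfl
  · intro q hq hq'
    simp only [Finset.mem_filter, not_and, not_le] at hq'
    rw [hz _ (hq' hq), ite_self]

lemma nctF_dfs (A : Set ℕ) (k m : ℕ) : (nctF A (k + 1) (m + 1) : ℝ) =
    ∑ j ∈ Finset.range (m + 1), PowerSeries.coeff j (nctW A) * nctF A (k + j) m := by
  obtain ⟨P, hpow, hP⟩ := nctS_succ A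
  have h1 : (nctF A (k + 1) (m + 1) : ℝ) = PowerSeries.coeff (m + 1) (nctS A (k + 1)) := by
    rw [nctS, PowerSeries.coeff_mk]
  rw [h1, hpow, pow_succ', mul_assoc, PowerSeries.coeff_succ_X_mul, ← hpow, PowerSeries.coeff_mul]
  have h2 : ∀ p ∈ Finset.HasAntidiagonal.antidiagonal m,
      PowerSeries.coeff p.1 P * PowerSeries.coeff p.2 (nctS A k) =
      ∑ j ∈ Finset.range (m + 1), PowerSeries.coeff j (nctW A) *
        (PowerSeries.coeff p.1 (nctS A j) * PowerSeries.coeff p.2 (nctS A k)) := by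
    intro p hp
    rw [Finset.HasAntidiagonal.mem_antidiagonal] at hp
    rw [hP p.1 (m + 1) (by omega), Finset.sum_mul]
    apply Finset.sum_congr rfl
    intro j _
    ring
  rw [Finset.sum_congr rfl h2, Finset.sum_comm]
  apply Finset.sum_congr rfl
  intro j _
  rw [← Finset.mul_sum, ← PowerSeries.coeff_mul, hpow, hpow, ← pow_add, ← hpow, add_comm j k, nctS,
    PowerSeries.coeff_mk]

lemma nct_deriv_id (W : PowerSeries ℝ) (m n : ℕ) :
    ((m : ℝ) + 1) * ∑ p ∈ Finset.HasAntidiagonal.antidiagonal n,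
      (p.1 : ℝ) * PowerSeries.coeff p.1 W * PowerSeries.coeff p.2 (W ^ m) =
    n * PowerSeries.coeff n (W ^ (m + 1)) := by
  have hX : ∀ (V : PowerSeries ℝ) (n : ℕ), PowerSeries.coeff n (PowerSeries.X *
      (PowerSeries.derivative ℝ V)) = n * PowerSeries.coeff n V := by
    intro V n
    rcases n with _ | n
    · simp
    · rw [PowerSeries.coeff_succ_X_mul, PowerSeries.coeff_derivative]
      push_cast; ring
  rw [← hX, Derivation.leibniz_pow]
  have : PowerSeries.X * ((m + 1) • W ^ (m + 1 - 1) • (PowerSeries.derivative ℝ) W) =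
      (PowerSeries.C ((m : ℝ) + 1)) * ((PowerSeries.X * (PowerSeries.derivative ℝ) W) * W ^ m) := by
    simp
    ring
  rw [this, PowerSeries.coeff_C_mul, PowerSeries.coeff_mul]
  simp only [hX]

/-- Lagrange inversion. -/
lemma nctF_lagrange (A : Set ℕ) (m : ℕ) : ∀ k, k ≤ m → (m : ℝ) * nctF A k m =
    k * PowerSeries.coeff (m - k) (nctW A ^ m) := by
  induction m with
  | zero => intro k hk; simp at hk; simp [hk]
  | succ m ih =>
    intro k hk
    rcases k with _ | k
    · rw [nctF_zero]; simp
    rw [nctF_dfs]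
    have hkm : k ≤ m := by omega
    rcases Nat.eq_zero_or_pos m with rfl | hm
    · have : k = 0 := by omega
      subst this
      simp [nctF_zero]
    have hm' : (0 : ℝ) < m := by exact_mod_cast hm
    have e1 : (m : ℝ) * ∑ j ∈ Finset.range (m + 1), PowerSeries.coeff j (nctW A) * nctF A (k + j) m
        = ∑ p ∈ Finset.HasAntidiagonal.antidiagonal (m - k),
          ((k : ℝ) + p.1) * PowerSeries.coeff p.1 (nctW A) * PowerSeries.coeff p.2 (nctW A ^ m) := by
      rw [Finset.Nat.sum_antidiagonal_eq_sum_range_succ_mk, Finset.mul_sum]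
      symm
      apply Finset.sum_subset_zero_on_sdiff
      · intro x; simp only [Finset.mem_range]; omega
      · intro x hx
        simp only [Finset.mem_sdiff, Finset.mem_range] at hx
        rw [nctF_lt _ _ _ (by omega)]; simp
      · intro x hx
        simp only [Finset.mem_range] at hx
        have := ih (k + x) (by omega)
        rw [show m - k - x = m - (k + x) by omega]
        push_cast at this
        linear_combination (- PowerSeries.coeff x (nctW A)) * this
    have e2 : ∑ p ∈ Finset.HasAntidiagonal.antidiagonal (m - k),
          ((k : ℝ) + p.1) * PowerSeries.coeff p.1 (nctW A) * PowerSeries.coeff p.2 (nctW A ^ m) =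
        k * PowerSeries.coeff (m - k) (nctW A ^ (m + 1)) +
        ∑ p ∈ Finset.HasAntidiagonal.antidiagonal (m - k),
          (p.1 : ℝ) * PowerSeries.coeff p.1 (nctW A) * PowerSeries.coeff p.2 (nctW A ^ m) := by
      rw [pow_succ', PowerSeries.coeff_mul, Finset.mul_sum, ← Finset.sum_add_distrib]
      apply Finset.sum_congr rfl
      intro p _
      ring
    have e3 := nct_deriv_id (nctW A) m (m - k)
    rw [Nat.cast_sub hkm] at e3
    rw [show m + 1 - (k + 1) = m - k by omega]
    push_cast
    apply mul_left_cancel₀ hm'.ne'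
    rw [mul_left_comm, e1, e2, mul_add, e3]
    ring


/-! ### Part G1 -/
open Filter Set
open scoped Topology

/-! ## Geometry of points on the circle -/

/-- Orientation determinant. -/
noncomputable def nctO (z w x : ℂ) : ℝ := (w.re - z.re) * (x.im - z.im) - (w.im - z.im) * (x.re - z.re)

lemma nct_pos_re (n k : ℕ) : (ncPos n k).re = Real.cos (2 * Real.pi * k / n) := by
  have : -(2 * Real.pi * Complex.I) * k / n = ((-(2 * Real.pi * k / n) : ℝ) : ℂ) * Complex.I := by
    push_cast; ring
  rw [ncPos, this, Complex.exp_ofReal_mul_I_re, Real.cos_neg]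

lemma nct_pos_im (n k : ℕ) : (ncPos n k).im = - Real.sin (2 * Real.pi * k / n) := by
  have : -(2 * Real.pi * Complex.I) * k / n = ((-(2 * Real.pi * k / n) : ℝ) : ℂ) * Complex.I := by
    push_cast; ring
  rw [ncPos, this, Complex.exp_ofReal_mul_I_im, Real.sin_neg]

lemma nct_trig (a b c : ℝ) :
    (Real.cos (2 * b) - Real.cos (2 * a)) * (- Real.sin (2 * c) - - Real.sin (2 * a)) -
    (- Real.sin (2 * b) - - Real.sin (2 * a)) * (Real.cos (2 * c) - Real.cos (2 * a)) =
    - (4 * Real.sin (b - a) * Real.sin (c - b) * Real.sin (c - a)) := by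
  have e1 : Real.cos (2 * b) - Real.cos (2 * a) = - 2 * Real.sin (b + a) * Real.sin (b - a) := by
    rw [Real.cos_sub_cos]; ring_nf
  have e2 : Real.cos (2 * c) - Real.cos (2 * a) = - 2 * Real.sin (c + a) * Real.sin (c - a) := by
    rw [Real.cos_sub_cos]; ring_nf
  have e3 : Real.sin (2 * b) - Real.sin (2 * a) = 2 * Real.sin (b - a) * Real.cos (b + a) := by
    rw [Real.sin_sub_sin]; ring_nf
  have e4 : Real.sin (2 * c) - Real.sin (2 * a) = 2 * Real.sin (c - a) * Real.cos (c + a) := by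
    rw [Real.sin_sub_sin]; ring_nf
  have e5 : Real.sin (c - b) = Real.sin (c + a) * Real.cos (b + a) -
      Real.cos (c + a) * Real.sin (b + a) := by
    rw [← Real.sin_sub]; ring_nf
  rw [show - Real.sin (2 * c) - - Real.sin (2 * a) = -(Real.sin (2 * c) - Real.sin (2 * a)) by ring,
    show - Real.sin (2 * b) - - Real.sin (2 * a) = -(Real.sin (2 * b) - Real.sin (2 * a)) by ring,
    e1, e2, e3, e4, e5]
  ring

lemma nctO_neg (n a b c : ℕ) (h1 : a < b) (h2 : b < c) (h3 : c < n) :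
    nctO (ncPos n a) (ncPos n b) (ncPos n c) < 0 := by
  have hn : (0 : ℝ) < n := by exact_mod_cast (by omega : 0 < n)
  have hpos : ∀ x y : ℕ, x < y → y < n →
      0 < Real.sin (Real.pi * y / n - Real.pi * x / n) := by
    intro x y hxy hy
    have hxy' : (x : ℝ) < y := by exact_mod_cast hxy
    have hy' : (y : ℝ) < n := by exact_mod_cast hy
    have hx0 : (0 : ℝ) ≤ x := by positivity
    apply Real.sin_pos_of_pos_of_lt_pi
    · rw [← sub_div, ← mul_sub]
      have := sub_pos.2 hxy'
      have := Real.pi_pos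
      positivity
    · rw [← sub_div, div_lt_iff₀ hn, ← mul_sub]
      apply mul_lt_mul_of_pos_left _ Real.pi_pos
      linarith
  rw [nctO, nct_pos_re, nct_pos_re, nct_pos_re, nct_pos_im, nct_pos_im, nct_pos_im]
  have e : ∀ k : ℕ, 2 * Real.pi * k / n = 2 * (Real.pi * k / n) := fun k => by ring
  rw [e a, e b, e c, nct_trig]
  have := hpos a b h1 (by omega)
  have := hpos b c h2 h3
  have := hpos a c (by omega) h3
  rw [neg_lt_zero]
  positivity

lemma nctO_rot (z w x : ℂ) : nctO z w x = nctO w x z := by unfold nctO; ring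
lemma nctO_swap (z w x : ℂ) : nctO z w x = - nctO w z x := by unfold nctO; ring
lemma nctO_self1 (z w : ℂ) : nctO z w z = 0 := by unfold nctO; ring
lemma nctO_self2 (z w : ℂ) : nctO z w w = 0 := by unfold nctO; ring

lemma nctO_seg (p q x y : ℂ) (s t : ℝ) (hst : s + t = 1) :
    nctO p q (s • x + t • y) = s * nctO p q x + t * nctO p q y := by
  have : s = 1 - t := by linarith
  subst this
  simp [nctO]
  ring

/-- crossing chords intersect away from endpoints -/
lemma nct_cross_geom (n a b c d : ℕ) (h1 : a < c) (h2 : c < b) (h3 : b < d) (h4 : d < n) :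
    ∃ z, z ∈ segment ℝ (ncPos n a) (ncPos n b) ∧ z ∈ segment ℝ (ncPos n c) (ncPos n d) ∧
      z ≠ ncPos n a ∧ z ≠ ncPos n b := by
  set pa := ncPos n a
  set pb := ncPos n b
  set pc := ncPos n c
  set pd := ncPos n d
  have acb : nctO pa pc pb < 0 := nctO_neg n a c b h1 h2 (by omega)
  have acd : nctO pa pc pd < 0 := nctO_neg n a c d h1 (by omega) h4
  have abd : nctO pa pb pd < 0 := nctO_neg n a b d (by omega) h3 h4
  have cbd : nctO pc pb pd < 0 := nctO_neg n c b d h2 h3 h4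
  have u1 : nctO pc pd pa < 0 := by rwa [← nctO_rot]
  have u2 : 0 < nctO pc pd pb := by
    rw [nctO_rot, nctO_swap, ← nctO_rot] at *
    have : nctO pc pb pd = - nctO pb pc pd := nctO_swap _ _ _
    have e : nctO pc pd pb = nctO pb pc pd := by rw [nctO_rot pb pc pd]
    linarith [nctO_swap pd pb pc, nctO_rot pc pd pb, nctO_rot pd pb pc, nctO_rot pb pd pc, nctO_rot pc pb pd]
  have v2 : nctO pa pb pd < 0 := abd
  have v1 : 0 < nctO pa pb pc := by
    have e1 := nctO_rot pa pb pc
    have e2 := nctO_rot pb pc pa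
    have e3 := nctO_swap pa pc pb
    linarith [nctO_rot pa pc pb, nctO_rot pc pb pa]
  set t := nctO pc pd pa / (nctO pc pd pa - nctO pc pd pb) with ht
  set s := nctO pa pb pc / (nctO pa pb pc - nctO pa pb pd) with hs
  have hd1 : nctO pc pd pa - nctO pc pd pb < 0 := by linarith
  have hd2 : 0 < nctO pa pb pc - nctO pa pb pd := by linarith
  have ht0 : 0 < t := div_pos_of_neg_of_neg u1 hd1
  have ht1 : t < 1 := by rw [ht, div_lt_one_of_neg hd1]; linarith
  have hs0 : 0 < s := div_pos v1 hd2
  have hs1 : s < 1 := by rw [hs, div_lt_one hd2]; linarith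
  have hz : (1 - t) • pa + t • pb = (1 - s) • pc + s • pd := by
    have hne1 : nctO pc pd pa - nctO pc pd pb ≠ 0 := hd1.ne
    have hne2 : nctO pa pb pc - nctO pa pb pd ≠ 0 := hd2.ne'
    have hD : nctO pa pb pc - nctO pa pb pd = -(nctO pc pd pb - nctO pc pd pa) * (-1) * (-1) ∨ True := Or.inr trivial
    rw [ht, hs]
    apply Complex.ext
    · simp only [Complex.add_re, Complex.real_smul, Complex.re_ofReal_mul]
      field_simp
      unfold nctO
      ring
    · simp only [Complex.add_im, Complex.real_smul, Complex.im_ofReal_mul]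
      field_simp
      unfold nctO
      ring
  have hO : nctO pc pd ((1 - t) • pa + t • pb) = 0 := by
    rw [hz, nctO_seg _ _ _ _ _ _ (by ring), nctO_self1, nctO_self2]; ring
  refine ⟨(1 - t) • pa + t • pb, ⟨1 - t, t, by linarith, by linarith, by ring, rfl⟩, ?_, ?_, ?_⟩
  · rw [hz]
    exact ⟨1 - s, s, by linarith, by linarith, by ring, rfl⟩
  · intro h
    rw [h] at hO
    linarith
  · intro h
    rw [h] at hO
    linarith

lemma nct_noncross_geom (n a b c d : ℕ) (hab : a < b) (hbn : b < n) (hcn : c < n) (hdn : d < n)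
    (hcd : c ≠ d) (hne : ({a, b} : Set ℕ) ≠ {c, d})
    (hside : (a ≤ c ∧ c ≤ b ∧ a ≤ d ∧ d ≤ b) ∨ ((c ≤ a ∨ b ≤ c) ∧ (d ≤ a ∨ b ≤ d))) {z : ℂ}
    (hz1 : z ∈ segment ℝ (ncPos n a) (ncPos n b)) (hz2 : z ∈ segment ℝ (ncPos n c) (ncPos n d)) :
    (z = ncPos n a ∨ z = ncPos n b) ∧ (z = ncPos n c ∨ z = ncPos n d) := by
  -- side function
  obtain ⟨f, hf0, hfseg, hfa, hfb, hfc, hfd⟩ : ∃ f : ℂ → ℝ, f z = 0 ∧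
      (∀ x y s t, s + t = 1 → f (s • x + t • y) = s * f x + t * f y) ∧
      (f (ncPos n a) = 0) ∧ f (ncPos n b) = 0 ∧
      (0 ≤ f (ncPos n c) ∧ (f (ncPos n c) = 0 → c = a ∨ c = b)) ∧
      (0 ≤ f (ncPos n d) ∧ (f (ncPos n d) = 0 → d = a ∨ d = b)) := by
    have hz0 : nctO (ncPos n a) (ncPos n b) z = 0 := by
      obtain ⟨s, t, _, _, hst, rfl⟩ := hz1
      rw [nctO_seg _ _ _ _ _ _ hst, nctO_self1, nctO_self2]; ring
    have hin : ∀ x, a ≤ x → x ≤ b → 0 ≤ nctO (ncPos n a) (ncPos n b) (ncPos n x) ∧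
        (nctO (ncPos n a) (ncPos n b) (ncPos n x) = 0 → x = a ∨ x = b) := by
      intro x h1 h2
      rcases eq_or_lt_of_le h1 with rfl | h1
      · simp [nctO_self1]
      rcases eq_or_lt_of_le h2 with rfl | h2
      · simp [nctO_self2]
      have := nctO_neg n a x b h1 h2 hbn
      have e : nctO (ncPos n a) (ncPos n b) (ncPos n x) =
        - nctO (ncPos n a) (ncPos n x) (ncPos n b) := by unfold nctO; ring
      rw [e]
      exact ⟨by linarith, fun h => by linarith⟩
    have hout : ∀ x, x < n → x ≤ a ∨ b ≤ x → 0 ≤ - nctO (ncPos n a) (ncPos n b) (ncPos n x) ∧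
        (- nctO (ncPos n a) (ncPos n b) (ncPos n x) = 0 → x = a ∨ x = b) := by
      intro x hx h
      rcases h with h | h
      · rcases eq_or_lt_of_le h with rfl | h1
        · simp [nctO_self1]
        have := nctO_neg n x a b h1 hab hbn
        rw [nctO_rot] at this
        exact ⟨by linarith, fun h => by linarith⟩
      · rcases eq_or_lt_of_le h with rfl | h1
        · simp [nctO_self2]
        have := nctO_neg n a b x hab h1 hx
        exact ⟨by linarith, fun h => by linarith⟩
    rcases hside with h | h
    · exact ⟨nctO (ncPos n a) (ncPos n b), hz0, nctO_seg _ _, nctO_self1 _ _, nctO_self2 _ _,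
        hin c h.1 h.2.1, hin d h.2.2.1 h.2.2.2⟩
    · refine ⟨fun x => - nctO (ncPos n a) (ncPos n b) x, by simp [hz0], ?_, ?_, ?_,
        hout c hcn h.1, hout d hdn h.2⟩
      · intro x y s t hst
        dsimp only; rw [nctO_seg _ _ _ _ _ _ hst]; ring
      · simp [nctO_self1]
      · simp [nctO_self2]
  obtain ⟨s, t, hs, ht, hst, rfl⟩ := hz2
  rw [hfseg _ _ _ _ hst] at hf0
  have p1 : 0 ≤ s * f (ncPos n c) := mul_nonneg hs hfc.1
  have p2 : 0 ≤ t * f (ncPos n d) := mul_nonneg ht hfd.1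
  have q1 : s * f (ncPos n c) = 0 := by linarith
  have q2 : t * f (ncPos n d) = 0 := by linarith
  rcases mul_eq_zero.1 q1 with h1 | h1
  · have ht1 : t = 1 := by linarith
    subst h1 ht1
    rcases mul_eq_zero.1 q2 with h2 | h2
    · norm_num at h2
    have := hfd.2 h2
    simp only [zero_smul, one_smul, zero_add, or_true, and_true]
    rcases this with rfl | rfl <;> simp
  · rcases mul_eq_zero.1 q2 with h2 | h2
    · have ht1 : s = 1 := by linarith
      subst h2 ht1
      have := hfc.2 h1
      simp only [zero_smul, one_smul, add_zero, true_or, and_true]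
      rcases this with rfl | rfl <;> simp
    · exfalso
      apply hne
      rcases hfc.2 h1 with rfl | rfl <;> rcases hfd.2 h2 with rfl | rfl
      · exact absurd rfl hcd
      · rfl
      · exact Set.pair_comm _ _
      · exact absurd rfl hcd

lemma nct_geom_iff (n : ℕ) (G : SimpleGraph (Fin n)) :
    (∀ a b c d : Fin n, G.Adj a b → G.Adj c d →
    ({(a : ℕ), (b : ℕ)} : Set ℕ) ≠ {(c : ℕ), (d : ℕ)} →
    segment ℝ (ncPos n a) (ncPos n b) ∩ segment ℝ (ncPos n c) (ncPos n d) ⊆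
      {z : ℂ | (z = ncPos n a ∨ z = ncPos n b) ∧ (z = ncPos n c ∨ z = ncPos n d)}) ↔
    ∀ a b c d : Fin n, G.Adj a b → G.Adj c d → a < c → c < b → b < d → False := by
  constructor
  · intro h a b c d hab hcd h1 h2 h3
    obtain ⟨z, hz1, hz2, n1, n2⟩ := nct_cross_geom n a b c d h1 h2 h3 d.2
    have := h a b c d hab hcd ?_ ⟨hz1, hz2⟩
    · rcases this.1 with h | h
      · exact n1 h
      · exact n2 h
    · intro he
      have : (a : ℕ) ∈ ({(c : ℕ), (d : ℕ)} : Set ℕ) := by rw [← he]; simp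
      simp only [Set.mem_insert_iff, Set.mem_singleton_iff] at this
      omega
  · intro h
    have key : ∀ a b c d : Fin n, a < b → G.Adj a b → G.Adj c d →
        ({(a : ℕ), (b : ℕ)} : Set ℕ) ≠ {(c : ℕ), (d : ℕ)} →
        ∀ z, z ∈ segment ℝ (ncPos n a) (ncPos n b) → z ∈ segment ℝ (ncPos n c) (ncPos n d) →
        ((z = ncPos n a ∨ z = ncPos n b) ∧ (z = ncPos n c ∨ z = ncPos n d)) := by
      intro a b c d hlt hab hcd hne z hz1 hz2
      refine nct_noncross_geom n a b c d hlt b.2 c.2 d.2 ?_ hne ?_ hz1 hz2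
      · intro e
        exact hcd.ne (Fin.ext e)
      · have h1 := h a b c d hab hcd
        have h2 := h a b d c hab hcd.symm
        have h3 := h c d a b hcd hab
        have h4 := h d c a b hcd.symm hab
        by_contra hcon
        simp only [Fin.lt_def] at *
        by_cases x1 : (a : ℕ) < c ∧ (c : ℕ) < b
        · by_cases x2 : (b : ℕ) < d
          · exact h1 x1.1 x1.2 x2
          · by_cases x3 : (d : ℕ) < a
            · exact h4 x3 x1.1 x1.2
            · omega
        · by_cases x1' : (a : ℕ) < d ∧ (d : ℕ) < b
          · by_cases x2 : (b : ℕ) < c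
            · exact h2 x1'.1 x1'.2 x2
            · by_cases x3 : (c : ℕ) < a
              · exact h3 x3 x1'.1 x1'.2
              · omega
          · omega
    rintro a b c d hab hcd hne z ⟨hz1, hz2⟩
    rcases lt_or_gt_of_ne hab.ne with hlt | hlt
    · exact key a b c d hlt hab hcd hne z hz1 hz2
    · have := key b a c d hlt hab.symm hcd (by rwa [Set.pair_comm]) z (by rwa [segment_symm]) hz2
      exact ⟨this.1.symm, this.2⟩


/-! ### Part G2 -/
open Filter Set
open scoped Topology

/-! ## Transfer to integer intervals -/

/-- The embedding of `Fin n` into the integers. -/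
def nctE (n : ℕ) : Fin n ↪ ℤ := ⟨fun i => (i : ℕ), fun i j h => by ext; simpa using h⟩

lemma nctE_apply (n : ℕ) (i : Fin n) : nctE n i = ((i : ℕ) : ℤ) := rfl

lemma nctE_lt (n : ℕ) {a b : Fin n} : nctE n a < nctE n b ↔ a < b := by
  simp [nctE_apply]

lemma nctE_range {m : ℕ} (x : ℤ) (h0 : 0 ≤ x) (h1 : x ≤ m) : ∃ i : Fin (m + 1), nctE (m + 1) i = x :=
  ⟨⟨x.toNat, by omega⟩, by simp [nctE_apply, h0]⟩

lemma nctE_bd {m : ℕ} (i : Fin (m + 1)) : 0 ≤ nctE (m + 1) i ∧ nctE (m + 1) i ≤ m := by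
  have := i.2
  simp only [nctE_apply]; omega

lemma nct_map_acyclic {V W : Type*} [Nonempty V] (e : V ↪ W) (G : SimpleGraph V)
    (h : G.IsAcyclic) : (G.map e).IsAcyclic := by
  rw [SimpleGraph.isAcyclic_iff_forall_adj_isBridge] at h ⊢
  intro u' v' huv
  obtain ⟨u, v, huv1, rfl, rfl⟩ := (SimpleGraph.map_adj _ _ _ _).1 huv
  have h1 := h huv1
  rw [SimpleGraph.isBridge_iff] at h1 ⊢
  intro hr
  apply h1
  have hi : ∀ x, Function.invFun e (e x) = x := Function.leftInverse_invFun e.injective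
  have := nct_reach_map (H := G.deleteEdges {s(u, v)}) (Function.invFun e) ?_ hr
  · rwa [hi, hi] at this
  · intro x y hxy
    rw [SimpleGraph.deleteEdges_adj] at hxy
    obtain ⟨hxy, hne⟩ := hxy
    obtain ⟨a, b, hab, rfl, rfl⟩ := (SimpleGraph.map_adj _ _ _ _).1 hxy
    rw [hi, hi]
    apply SimpleGraph.Adj.reachable
    rw [SimpleGraph.deleteEdges_adj]
    refine ⟨hab, ?_⟩
    intro h2
    apply hne
    have h3 : s(a, b) = s(u, v) := h2
    have := congrArg (Sym2.map e) h3
    simpa using this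

lemma nct_of_tree {m : ℕ} (G : SimpleGraph (Fin (m + 1))) (hG : G.IsTree)
    (hnc : ∀ a b c d : Fin (m + 1), G.Adj a b → G.Adj c d → a < c → c < b → b < d → False) :
    Nct 0 m (G.map (nctE (m + 1))) where
  supp := by
    intro u v huv
    obtain ⟨a, b, hab, rfl, rfl⟩ := (SimpleGraph.map_adj _ _ _ _).1 huv
    exact nctE_bd a
  nc := by
    intro a b c d hab hcd h1 h2 h3
    obtain ⟨a, b, hab', rfl, rfl⟩ := (SimpleGraph.map_adj _ _ _ _).1 hab
    obtain ⟨c, d, hcd', rfl, rfl⟩ := (SimpleGraph.map_adj _ _ _ _).1 hcd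
    rw [nctE_lt] at h1 h2 h3
    exact hnc a b c d hab' hcd' h1 h2 h3
  acyc := nct_map_acyclic _ _ hG.2
  conn := by
    intro u h0 h1
    obtain ⟨i, rfl⟩ := nctE_range u h0 h1
    have := hG.1.preconnected 0 i
    have h2 := nct_reach_map (H := G.map (nctE (m + 1))) (nctE (m + 1)) ?_ this
    · simpa [nctE_apply] using h2
    · intro u v huv
      apply SimpleGraph.Adj.reachable
      exact (SimpleGraph.map_adj _ _ _ _).2 ⟨u, v, huv, rfl, rfl⟩

lemma tree_of_nct {m : ℕ} (H : SimpleGraph ℤ) (hH : Nct 0 m H) :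
    (H.comap (nctE (m + 1))).IsTree ∧
    (∀ a b c d : Fin (m + 1), (H.comap (nctE (m + 1))).Adj a b → (H.comap (nctE (m + 1))).Adj c d →
      a < c → c < b → b < d → False) := by
  constructor
  · refine ⟨?_, hH.acyc.of_comap _⟩
    rw [SimpleGraph.connected_iff_exists_forall_reachable]
    refine ⟨0, fun i => ?_⟩
    have hi : ∀ x, Function.invFun (nctE (m + 1)) (nctE (m + 1) x) = x :=
      Function.leftInverse_invFun (nctE (m + 1)).injective
    have h1 := hH.conn (nctE (m + 1) i) (nctE_bd i).1 (nctE_bd i).2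
    have h2 := nct_reach_map (H := H.comap (nctE (m + 1))) (Function.invFun (nctE (m + 1))) ?_ h1
    · rw [hi] at h2
      have : (0 : ℤ) = nctE (m + 1) 0 := by simp [nctE_apply]
      rw [this, hi] at h2
      exact h2
    · intro u v huv
      have h3 := hH.supp' huv
      obtain ⟨a, rfl⟩ := nctE_range u h3.1 h3.2.1
      obtain ⟨b, rfl⟩ := nctE_range v h3.2.2.1 h3.2.2.2.1
      rw [hi, hi]
      apply SimpleGraph.Adj.reachable
      exact huv
  · intro a b c d hab hcd h1 h2 h3
    exact hH.nc _ _ _ _ hab hcd ((nctE_lt _).2 h1) ((nctE_lt _).2 h2) ((nctE_lt _).2 h3)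

lemma nct_map_comap {m : ℕ} (H : SimpleGraph ℤ) (hH : Nct 0 m H) :
    (H.comap (nctE (m + 1))).map (nctE (m + 1)) = H := by
  ext u v
  rw [SimpleGraph.map_adj]
  constructor
  · rintro ⟨a, b, hab, rfl, rfl⟩
    exact hab
  · intro huv
    have h3 := hH.supp' huv
    obtain ⟨a, rfl⟩ := nctE_range u h3.1 h3.2.1
    obtain ⟨b, rfl⟩ := nctE_range v h3.2.2.1 h3.2.2.2.1
    exact ⟨a, b, huv, rfl, rfl⟩

lemma nctD_map {m : ℕ} (G : SimpleGraph (Fin (m + 1))) (i : Fin (m + 1)) :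
    nctD (G.map (nctE (m + 1))) (nctE (m + 1) i) = Set.ncard {w | G.Adj i w} := by
  unfold nctD
  rw [← Set.ncard_image_of_injective _ (nctE (m + 1)).injective]
  congr 1
  ext w
  constructor
  · intro h
    obtain ⟨a, b, hab, h1, rfl⟩ := (SimpleGraph.map_adj _ _ _ _).1 h
    have := (nctE (m + 1)).injective h1
    subst this
    exact ⟨b, hab, rfl⟩
  · rintro ⟨b, hb, rfl⟩
    exact (SimpleGraph.map_adj _ _ _ _).2 ⟨i, b, hb, rfl, rfl⟩

/-- All degree-constrained noncrossing trees on `[0, m]`. -/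
def nctT (A : Set ℕ) (m : ℕ) : Set (SimpleGraph ℤ) :=
  {G | Nct 0 m G ∧ ∀ v : ℤ, 0 ≤ v → v ≤ m → nctD G v ∈ A}

lemma nct_card_eq (A : Set ℕ) (m : ℕ) :
    Nat.card {θ : NCTree (m + 1) // ∀ v : Fin (m + 1), ncDeg (m + 1) θ v ∈ A} =
      (nctT A m).ncard := by
  rw [← Nat.card_coe_set_eq]
  refine Nat.card_congr (Equiv.ofBijective (fun θ => ⟨θ.1.adj.map (nctE (m + 1)), ?_, ?_⟩) ⟨?_, ?_⟩)
  · exact nct_of_tree _ θ.1.isTree ((nct_geom_iff _ _).1 θ.1.noncrossing)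
  · intro v h0 h1
    obtain ⟨i, rfl⟩ := nctE_range v h0 h1
    rw [nctD_map]
    exact θ.2 i
  · intro θ θ' h
    have h1 : θ.1.adj.map (nctE (m + 1)) = θ'.1.adj.map (nctE (m + 1)) := congrArg Subtype.val h
    have h2 : θ.1.adj = θ'.1.adj := SimpleGraph.map_injective _ h1
    apply Subtype.ext
    rcases θ with ⟨⟨a, b, c⟩, e⟩
    rcases θ' with ⟨⟨a', b', c'⟩, e'⟩
    simp only at h2 ⊢
    subst h2
    rfl
  · rintro ⟨H, hH, hD⟩
    have h1 := tree_of_nct H hH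
    have hdeg : ∀ v : Fin (m + 1), Set.ncard {w | (H.comap (nctE (m + 1))).Adj v w} ∈ A := by
      intro v
      have := hD (nctE (m + 1) v) (nctE_bd v).1 (nctE_bd v).2
      rw [← nct_map_comap H hH, nctD_map] at this
      exact this
    refine ⟨⟨⟨H.comap (nctE (m + 1)), h1.1, (nct_geom_iff _ _).2 h1.2⟩, hdeg⟩, ?_⟩
    apply Subtype.ext
    exact nct_map_comap H hH

open Classical in
lemma nctT_card (A : Set ℕ) (m : ℕ) :
    (nctT A m).ncard = ∑ k ∈ Finset.range (m + 1), if k ∈ A then nctF A k m else 0 := by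
  have hfin : (nctT A m).Finite := (nct_finite 0 m).subset fun G hG => hG.1
  rw [Set.ncard_eq_toFinset_card _ hfin]
  rw [Finset.card_eq_sum_card_fiberwise (f := fun G => nctD G 0) (t := Finset.range (m + 1))]
  · apply Finset.sum_congr rfl
    intro k hk
    split_ifs with hkA
    · unfold nctF
      rw [Set.ncard_eq_toFinset_card _ (nctX_finite _ _ _ _)]
      congr 1
      ext G
      simp only [Finset.mem_filter, Set.Finite.mem_toFinset]
      constructor
      · rintro ⟨⟨h1, h2⟩, h3⟩
        exact ⟨h1, h3, fun v hv hv' => h2 v hv.le hv'⟩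
      · rintro ⟨h1, h3, h2⟩
        refine ⟨⟨h1, fun v hv hv' => ?_⟩, h3⟩
        rcases eq_or_lt_of_le hv with rfl | hv
        · rw [h3]; exact hkA
        · exact h2 v hv hv'
    · rw [Finset.card_eq_zero, Finset.filter_eq_empty_iff]
      intro G hG h
      rw [Set.Finite.mem_toFinset] at hG
      apply hkA
      rw [← h]
      exact hG.2 0 le_rfl (by positivity)
  · intro G hG
    rw [Finset.mem_coe, Set.Finite.mem_toFinset] at hG
    have := hG.1.deg_le 0 le_rfl (by positivity)
    simp at this ⊢
    omega

open Classical in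
/-- The number of degree-constrained noncrossing trees, via Lagrange inversion. -/
lemma nct_count (A : Set ℕ) (m : ℕ) :
    (m : ℝ) * (Nat.card {θ : NCTree (m + 1) // ∀ v : Fin (m + 1), ncDeg (m + 1) θ v ∈ A} : ℝ) =
      ∑ k ∈ Finset.range (m + 1),
        if k ∈ A then (k : ℝ) * PowerSeries.coeff (m - k) (nctW A ^ m) else 0 := by
  rw [nct_card_eq, nctT_card]
  push_cast
  rw [Finset.mul_sum]
  apply Finset.sum_congr rfl
  intro k hk
  rw [Finset.mem_range] at hk
  split_ifs with h
  · exact nctF_lagrange A m k (by omega)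
  · simp


/-! ### Part A1 -/
open Filter Set
open scoped Topology

/-! ## A local limit theorem -/

/-- A centred-step lattice distribution on the nonnegative integers. -/
structure NctP (p : ℕ → ℝ) (d : ℕ) (v : ℝ) : Prop where
  nonneg : ∀ k, 0 ≤ p k
  sum : HasSum p 1
  mean : HasSum (fun k : ℕ => ((k : ℝ) - 1) * p k) 0
  var : HasSum (fun k : ℕ => ((k : ℝ) - 1) ^ 2 * p k) v
  vpos : 0 < v
  p0 : 0 < p 0
  ddvd : ∀ k, p k ≠ 0 → d ∣ k
  dgcd : ∀ e, (∀ k, p k ≠ 0 → e ∣ k) → e ∣ d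
  dpos : 0 < d

/-- The terms of the characteristic function of the centred step. -/
noncomputable def nctXt (p : ℕ → ℝ) (t : ℝ) (k : ℕ) : ℂ :=
  (p k : ℂ) * Complex.exp (Complex.I * ((t * ((k : ℝ) - 1) : ℝ) : ℂ))

/-- The characteristic function of the centred step. -/
noncomputable def nctXi (p : ℕ → ℝ) (t : ℝ) : ℂ := ∑' k, nctXt p t k

lemma nct_norm_expI (x : ℝ) : ‖Complex.exp (Complex.I * (x : ℂ))‖ = 1 := by
  rw [mul_comm]; exact Complex.norm_exp_ofReal_mul_I x

lemma nctXt_norm {p : ℕ → ℝ} (hp : ∀ k, 0 ≤ p k) (t : ℝ) (k : ℕ) : ‖nctXt p t k‖ = p k := by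
  rw [nctXt, norm_mul, nct_norm_expI, mul_one, Complex.norm_real, Real.norm_of_nonneg (hp k)]

lemma nctXt_summable {p : ℕ → ℝ} {d : ℕ} {v : ℝ} (h : NctP p d v) (t : ℝ) :
    Summable (nctXt p t) := by
  apply Summable.of_norm
  simp_rw [nctXt_norm h.nonneg]
  exact h.sum.summable

lemma nctXi_continuous {p : ℕ → ℝ} {d : ℕ} {v : ℝ} (h : NctP p d v) : Continuous (nctXi p) := by
  unfold nctXi
  refine continuous_tsum (u := p) ?_ h.sum.summable ?_
  · intro k
    unfold nctXt
    fun_prop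
  · intro k t
    rw [nctXt_norm h.nonneg]

lemma nct_exp_bound (y : ℝ) :
    ‖Complex.exp (Complex.I * (y : ℂ)) - 1 - Complex.I * (y : ℂ)‖ ≤ 3 * y ^ 2 := by
  have hn : ‖Complex.I * (y : ℂ)‖ = |y| := by simp
  by_cases hy : |y| ≤ 1
  · have := Complex.norm_exp_sub_one_sub_id_le (x := Complex.I * (y : ℂ)) (by rw [hn]; exact hy)
    rw [hn, sq_abs] at this
    nlinarith [sq_nonneg y]
  · push Not at hy
    have h1 : ‖Complex.exp (Complex.I * (y : ℂ)) - 1 - Complex.I * (y : ℂ)‖ ≤ 1 + 1 + |y| := by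
      refine (norm_sub_le _ _).trans ?_
      rw [hn]
      gcongr
      refine (norm_sub_le _ _).trans ?_
      rw [nct_norm_expI]; simp
    rw [← sq_abs]
    nlinarith

lemma nct_exp_taylor (y : ℝ) : Tendsto (fun t : ℝ =>
    (Complex.exp (Complex.I * ((t * y : ℝ) : ℂ)) - 1 - Complex.I * ((t * y : ℝ) : ℂ)) / (t : ℂ) ^ 2)
    (𝓝[≠] 0) (𝓝 (-(y : ℂ) ^ 2 / 2)) := by
  rw [tendsto_iff_norm_sub_tendsto_zero]
  have hlim : Tendsto (fun t : ℝ => |t| * (|y| ^ 3 * Real.exp (|t| * |y|))) (𝓝[≠] 0) (𝓝 0) := by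
    have : Continuous (fun t : ℝ => |t| * (|y| ^ 3 * Real.exp (|t| * |y|))) := by fun_prop
    have h2 := this.tendsto 0
    simp only [abs_zero, zero_mul] at h2
    exact h2.mono_left nhdsWithin_le_nhds
  refine squeeze_zero' (Eventually.of_forall fun _ => norm_nonneg _) ?_ hlim
  filter_upwards [self_mem_nhdsWithin] with t ht
  have ht : t ≠ 0 := ht
  have htc : (t : ℂ) ≠ 0 := by exact_mod_cast ht
  have h1 := Complex.norm_exp_sub_sum_le_norm_mul_exp (Complex.I * ((t * y : ℝ) : ℂ)) 3
  have hn : ‖Complex.I * ((t * y : ℝ) : ℂ)‖ = |t| * |y| := by simp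
  rw [hn] at h1
  have h2 : (Complex.exp (Complex.I * ((t * y : ℝ) : ℂ)) - 1 - Complex.I * ((t * y : ℝ) : ℂ))
      / (t : ℂ) ^ 2 - (-(y : ℂ) ^ 2 / 2) =
      (Complex.exp (Complex.I * ((t * y : ℝ) : ℂ)) -
        ∑ m ∈ Finset.range 3, (Complex.I * ((t * y : ℝ) : ℂ)) ^ m / (m.factorial : ℂ)) / (t : ℂ) ^ 2 := by
    simp only [Finset.sum_range_succ, Finset.sum_range_zero, Nat.factorial, mul_pow, Complex.I_sq]
    push_cast
    field_simp
    ring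
  rw [h2, norm_div, norm_pow, Complex.norm_real, Real.norm_eq_abs]
  rw [div_le_iff₀ (by positivity)]
  refine h1.trans (le_of_eq ?_)
  ring

lemma nctXi_taylor {p : ℕ → ℝ} {d : ℕ} {v : ℝ} (h : NctP p d v) :
    Tendsto (fun t : ℝ => (nctXi p t - 1) / (t : ℂ) ^ 2) (𝓝[≠] 0) (𝓝 (-(v : ℂ) / 2)) := by
  have key := tendsto_tsum_of_dominated_convergence (𝓕 := 𝓝[≠] (0 : ℝ))
    (f := fun (t : ℝ) (k : ℕ) => (p k : ℂ) *
      ((Complex.exp (Complex.I * ((t * ((k : ℝ) - 1) : ℝ) : ℂ)) - 1 -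
        Complex.I * ((t * ((k : ℝ) - 1) : ℝ) : ℂ)) / (t : ℂ) ^ 2))
    (g := fun k : ℕ => (p k : ℂ) * (-(((k : ℝ) - 1 : ℝ) : ℂ) ^ 2 / 2))
    (bound := fun k : ℕ => 3 * (((k : ℝ) - 1) ^ 2 * p k)) (h.var.summable.mul_left 3)
    (fun k => (nct_exp_taylor ((k : ℝ) - 1)).const_mul _) ?_
  · have e1 : ∑' k : ℕ, (p k : ℂ) * (-(((k : ℝ) - 1 : ℝ) : ℂ) ^ 2 / 2) = -(v : ℂ) / 2 := by
      have h1 := ((Complex.hasSum_ofReal.2 h.var).mul_left (-1 / 2 : ℂ)).tsum_eq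
      rw [show -(v : ℂ) / 2 = -1 / 2 * (v : ℂ) by ring, ← h1]
      congr 1
      ext k
      push_cast
      ring
    rw [e1] at key
    refine key.congr' ?_
    filter_upwards [self_mem_nhdsWithin] with t ht
    have ht : t ≠ 0 := ht
    have htc : (t : ℂ) ≠ 0 := by exact_mod_cast ht
    have s1 := (nctXt_summable h t).hasSum
    have s2 := Complex.hasSum_ofReal.2 h.sum
    have s3 := (Complex.hasSum_ofReal.2 h.mean).mul_left (Complex.I * t)
    have s4 := (((s1.sub s2).sub s3).mul_right ((t : ℂ) ^ 2)⁻¹).tsum_eq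
    have : (nctXi p t - 1) / (t : ℂ) ^ 2 = (∑' k, nctXt p t k - ((1 : ℝ) : ℂ) -
      Complex.I * t * ((0 : ℝ) : ℂ)) * ((t : ℂ) ^ 2)⁻¹ := by
      rw [nctXi]; simp [div_eq_mul_inv]
    rw [this, ← s4]
    congr 1
    ext k
    rw [nctXt]
    push_cast
    field_simp
  · filter_upwards [self_mem_nhdsWithin] with t ht k
    have ht : t ≠ 0 := ht
    have h1 := nct_exp_bound (t * ((k : ℝ) - 1))
    rw [norm_mul, Complex.norm_real, Real.norm_of_nonneg (h.nonneg k), norm_div, norm_pow,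
      Complex.norm_real, Real.norm_eq_abs, sq_abs]
    have h2 : ‖Complex.exp (Complex.I * ((t * ((k : ℝ) - 1) : ℝ) : ℂ)) - 1 -
        Complex.I * ((t * ((k : ℝ) - 1) : ℝ) : ℂ)‖ / t ^ 2 ≤ 3 * ((k : ℝ) - 1) ^ 2 := by
      rw [div_le_iff₀ (by positivity)]
      refine h1.trans (le_of_eq ?_)
      ring
    calc _ ≤ p k * (3 * ((k : ℝ) - 1) ^ 2) := mul_le_mul_of_nonneg_left h2 (h.nonneg k)
      _ = _ := by ring

lemma nctXi_near {p : ℕ → ℝ} {d : ℕ} {v : ℝ} (h : NctP p d v) :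
    ∃ δ > 0, ∀ t : ℝ, |t| < δ → ‖nctXi p t‖ ≤ Real.exp (-(v / 4) * t ^ 2) := by
  have hv := h.vpos
  have h1 := Metric.tendsto_nhdsWithin_nhds.1 (nctXi_taylor h) (v / 4) (by positivity)
  obtain ⟨δ, hδ, hd⟩ := h1
  refine ⟨min δ (Real.sqrt (1 / v)), by positivity, fun t ht => ?_⟩
  have ht1 : |t| < δ := lt_of_lt_of_le ht (min_le_left _ _)
  have ht2 : |t| < Real.sqrt (1 / v) := lt_of_lt_of_le ht (min_le_right _ _)
  have ht3 : v * t ^ 2 < 1 := by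
    rw [← sq_abs]
    have := (Real.lt_sqrt (abs_nonneg t)).1 ht2
    rw [lt_div_iff₀ hv] at this
    linarith
  by_cases h0 : t = 0
  · subst h0
    have : nctXi p 0 = 1 := by
      have := (Complex.hasSum_ofReal.2 h.sum).tsum_eq
      simp [nctXi, nctXt] at this ⊢
      exact this
    simp [this]
  have h2 := hd (x := t) h0 (by simpa using ht1)
  rw [dist_eq_norm] at h2
  have htc : (t : ℂ) ≠ 0 := by exact_mod_cast h0
  have e : nctXi p t = ((1 - v / 2 * t ^ 2 : ℝ) : ℂ) +
      ((nctXi p t - 1) / (t : ℂ) ^ 2 - -(v : ℂ) / 2) * (t : ℂ) ^ 2 := by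
    push_cast
    field_simp
    ring
  rw [e]
  refine (norm_add_le _ _).trans ?_
  rw [Complex.norm_real, Real.norm_of_nonneg (by nlinarith), norm_mul, norm_pow, Complex.norm_real,
    Real.norm_eq_abs, sq_abs]
  have h3 := Real.add_one_le_exp (-(v / 4) * t ^ 2)
  have h4 : ‖(nctXi p t - 1) / (t : ℂ) ^ 2 - -(v : ℂ) / 2‖ * t ^ 2 ≤ v / 4 * t ^ 2 :=
    mul_le_mul_of_nonneg_right h2.le (sq_nonneg _)
  linarith

lemma nct_unit_eq_one {a b : ℝ} (ha : 0 < a) (hb : 0 < b) {z : ℂ} (hz : ‖z‖ = 1)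
    (h : a + b ≤ ‖(a : ℂ) + b * z‖) : z = 1 := by
  have h1 : z.re ^ 2 + z.im ^ 2 = 1 := by
    have := Complex.sq_norm z
    rw [hz, Complex.normSq_apply] at this
    nlinarith
  have h2 : (a + b) ^ 2 ≤ (a + b * z.re) ^ 2 + (b * z.im) ^ 2 := by
    have h3 := Complex.sq_norm ((a : ℂ) + b * z)
    rw [Complex.normSq_apply] at h3
    simp at h3
    have h4 : (a + b) ^ 2 ≤ ‖(a : ℂ) + b * z‖ ^ 2 := by
      apply pow_le_pow_left₀ (by positivity) h
    nlinarith
  have h3 : 1 ≤ z.re := by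
    by_contra hc
    push Not at hc
    have : 0 < a * b * (1 - z.re) := by
      have : 0 < 1 - z.re := by linarith
      positivity
    have e : b ^ 2 * (z.re ^ 2 + z.im ^ 2) = b ^ 2 := by rw [h1, mul_one]
    nlinarith
  have h4 : z.re = 1 := by nlinarith [sq_nonneg z.im]
  have h5 : z.im = 0 := by
    rw [h4] at h1
    have : z.im ^ 2 = 0 := by linarith
    exact pow_eq_zero_iff (by norm_num) |>.1 this
  apply Complex.ext <;> simp [h4, h5]

lemma nctXi_lt_one {p : ℕ → ℝ} {d : ℕ} {v : ℝ} (h : NctP p d v) {t : ℝ} (ht : t ≠ 0)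
    (htd : |t| ≤ Real.pi / d) : ‖nctXi p t‖ < 1 := by
  by_contra hc
  push Not at hc
  have hdp : (0 : ℝ) < d := by exact_mod_cast h.dpos
  have key : ∀ k, p k ≠ 0 → Complex.exp (Complex.I * t) ^ k = 1 := by
    intro k hk
    rcases Nat.eq_zero_or_pos k with rfl | hk0
    · simp
    have hpk : 0 < p k := lt_of_le_of_ne (h.nonneg k) (Ne.symm hk)
    apply nct_unit_eq_one h.p0 hpk
    · rw [norm_pow, nct_norm_expI, one_pow]
    have e1 := (nctXt_summable h t).sum_add_tsum_compl (s := {0, k})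
    have e2 := h.sum.summable.sum_add_tsum_compl (s := {0, k})
    rw [Finset.sum_pair hk0.ne] at e1 e2
    rw [h.sum.tsum_eq] at e2
    have e3 : ‖∑' x : ↑((({0, k} : Finset ℕ) : Set ℕ)ᶜ), nctXt p t x‖ ≤
        ∑' x : ↑((({0, k} : Finset ℕ) : Set ℕ)ᶜ), p x := by
      refine (norm_tsum_le_tsum_norm ?_).trans (le_of_eq ?_)
      · simp_rw [nctXt_norm h.nonneg]
        exact h.sum.summable.subtype _
      · simp_rw [nctXt_norm h.nonneg]
    have e4 : ‖nctXi p t‖ ≤ ‖nctXt p t 0 + nctXt p t k‖ +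
        ∑' x : ↑((({0, k} : Finset ℕ) : Set ℕ)ᶜ), p x := by
      rw [nctXi, ← e1]
      exact (norm_add_le _ _).trans (by linarith)
    have e5 : nctXt p t 0 + nctXt p t k = Complex.exp (Complex.I * ((-t : ℝ) : ℂ)) *
        ((p 0 : ℂ) + p k * Complex.exp (Complex.I * t) ^ k) := by
      rw [nctXt, nctXt, ← Complex.exp_nat_mul, mul_add]
      congr 1
      · push_cast; ring_nf
      · rw [mul_left_comm, ← Complex.exp_add]
        congr 2
        push_cast; ring
    rw [e5, norm_mul, nct_norm_expI, one_mul] at e4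
    linarith
  have hord : orderOf (Complex.exp (Complex.I * t)) ∣ d :=
    h.dgcd _ fun k hk => orderOf_dvd_of_pow_eq_one (key k hk)
  have h1 : Complex.exp (Complex.I * t) ^ d = 1 := orderOf_dvd_iff_pow_eq_one.1 hord
  rw [← Complex.exp_nat_mul, Complex.exp_eq_one_iff] at h1
  obtain ⟨n, hn⟩ := h1
  have h2 : (d : ℝ) * t = n * (2 * Real.pi) := by
    have : ((d : ℝ) * t : ℂ) = n * (2 * Real.pi) := by
      apply mul_right_cancel₀ Complex.I_ne_zero
      push_cast
      linear_combination hn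
    exact_mod_cast this
  have h3 : |(d : ℝ) * t| ≤ Real.pi := by
    rw [abs_mul, abs_of_pos hdp]
    rw [le_div_iff₀ hdp] at htd
    linarith
  rw [h2, abs_mul, abs_of_pos (by positivity : (0 : ℝ) < 2 * Real.pi)] at h3
  have h4 : n = 0 := by
    by_contra hn0
    have : (1 : ℝ) ≤ |(n : ℝ)| := by exact_mod_cast Int.one_le_abs hn0
    nlinarith [Real.pi_pos]
  rw [h4] at h2
  simp at h2
  rcases h2 with h2 | h2
  · exact hdp.ne' (by exact_mod_cast h2)
  · exact ht h2

/-- Gaussian domination of the characteristic function. -/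
lemma nctXi_gauss {p : ℕ → ℝ} {d : ℕ} {v : ℝ} (h : NctP p d v) :
    ∃ c > 0, ∀ t : ℝ, |t| ≤ Real.pi / d → ‖nctXi p t‖ ≤ Real.exp (-c * t ^ 2) := by
  have hdp : (0 : ℝ) < d := by exact_mod_cast h.dpos
  have hv := h.vpos
  obtain ⟨δ, hδ, hnear⟩ := nctXi_near h
  set K : Set ℝ := {t | δ ≤ |t| ∧ |t| ≤ Real.pi / d} with hK
  have hKc : IsCompact K := by
    refine (isCompact_Icc (a := -(Real.pi / d)) (b := Real.pi / d)).of_isClosed_subset ?_ ?_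
    · apply IsClosed.inter
      · exact isClosed_le continuous_const continuous_abs
      · exact isClosed_le continuous_abs continuous_const
    · intro t ht
      exact abs_le.1 ht.2
  have hR : ∃ r < 1, 0 < r ∧ ∀ t ∈ K, ‖nctXi p t‖ ≤ r := by
    rcases K.eq_empty_or_nonempty with he | hne
    · exact ⟨1 / 2, by norm_num, by norm_num, by simp [he]⟩
    · obtain ⟨t0, ht0, hmax⟩ := hKc.exists_isMaxOn hne (nctXi_continuous h).norm.continuousOn
      have h1 : ‖nctXi p t0‖ < 1 := nctXi_lt_one h (by
        rintro rfl
        have := ht0.1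
        simp at this
        linarith) ht0.2
      refine ⟨max ‖nctXi p t0‖ (1 / 2), max_lt h1 (by norm_num), by positivity, fun t ht => ?_⟩
      exact (hmax ht).trans (le_max_left _ _)
  obtain ⟨r, hr1, hr0, hr⟩ := hR
  have hlog : 0 < - Real.log r := by
    have := Real.log_neg hr0 hr1
    linarith
  refine ⟨min (v / 4) (- Real.log r / (Real.pi / d) ^ 2), by positivity, fun t ht => ?_⟩
  by_cases h1 : |t| < δ
  · refine (hnear t h1).trans ?_
    apply Real.exp_le_exp.2
    have := mul_le_mul_of_nonneg_right (min_le_left (v / 4) (- Real.log r / (Real.pi / d) ^ 2))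
      (sq_nonneg t)
    linarith
  · push Not at h1
    refine (hr t ⟨h1, ht⟩).trans ?_
    rw [← Real.exp_log hr0]
    apply Real.exp_le_exp.2
    rw [Real.log_exp]
    have h2 := mul_le_mul_of_nonneg_right (min_le_right (v / 4) (- Real.log r / (Real.pi / d) ^ 2))
      (sq_nonneg t)
    have h3 : t ^ 2 ≤ (Real.pi / d) ^ 2 := by
      rw [← sq_abs]
      exact pow_le_pow_left₀ (abs_nonneg _) ht 2
    have h4 : - Real.log r / (Real.pi / d) ^ 2 * t ^ 2 ≤ - Real.log r := by
      rw [div_mul_eq_mul_div, div_le_iff₀ (by positivity)]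
      exact mul_le_mul_of_nonneg_left h3 hlog.le
    linarith


/-! ### Part A2 -/
open Filter Set
open scoped Topology

lemma nct_pow_sum (p : ℕ → ℝ) (hp : Summable fun k => ‖p k‖) (z : ℂ) (hz : ‖z‖ = 1) (m : ℕ) :
    (Summable fun j => ‖((PowerSeries.coeff j (PowerSeries.mk p ^ m) : ℝ) : ℂ) * z ^ j‖) ∧
    HasSum (fun j => ((PowerSeries.coeff j (PowerSeries.mk p ^ m) : ℝ) : ℂ) * z ^ j)
      ((∑' k, (p k : ℂ) * z ^ k) ^ m) := by
  have hp1 : Summable fun k => ‖(p k : ℂ) * z ^ k‖ := by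
    simpa [norm_mul, norm_pow, hz] using hp
  induction m with
  | zero =>
    have h0 : ∀ j, j ≠ 0 → ((PowerSeries.coeff j (PowerSeries.mk p ^ 0) : ℝ) : ℂ) * z ^ j = 0 := by
      intro j hj
      simp [PowerSeries.coeff_one, hj]
    have h1 := hasSum_single (f := fun j =>
      ((PowerSeries.coeff j (PowerSeries.mk p ^ 0) : ℝ) : ℂ) * z ^ j) 0 h0
    refine ⟨?_, ?_⟩
    · have h2 := hasSum_single (f := fun j =>
        ‖((PowerSeries.coeff j (PowerSeries.mk p ^ 0) : ℝ) : ℂ) * z ^ j‖) 0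
          (fun j hj => by rw [h0 j hj, norm_zero])
      exact h2.summable
    · simpa using h1
  | succ m ih =>
    have e : ∀ j, ((PowerSeries.coeff j (PowerSeries.mk p ^ (m + 1)) : ℝ) : ℂ) * z ^ j =
        ∑ kl ∈ Finset.HasAntidiagonal.antidiagonal j,
          (((PowerSeries.coeff kl.1 (PowerSeries.mk p ^ m) : ℝ) : ℂ) * z ^ kl.1) *
            ((p kl.2 : ℂ) * z ^ kl.2) := by
      intro j
      rw [pow_succ, PowerSeries.coeff_mul]
      push_cast
      rw [Finset.sum_mul]
      apply Finset.sum_congr rfl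
      intro kl hkl
      rw [Finset.HasAntidiagonal.mem_antidiagonal] at hkl
      rw [← hkl, pow_add, PowerSeries.coeff_mk]
      ring
    have s1 := summable_norm_sum_mul_antidiagonal_of_summable_norm ih.1 hp1
    have s2 := tsum_mul_tsum_eq_tsum_sum_antidiagonal_of_summable_norm ih.1 hp1
    simp_rw [← e] at s1 s2
    refine ⟨s1, ?_⟩
    rw [pow_succ (∑' k, (p k : ℂ) * z ^ k) m, ← ih.2.tsum_eq, s2]
    exact s1.of_norm.hasSum

lemma nct_pow_supp (p : ℕ → ℝ) (d : ℕ) (hp : ∀ k, p k ≠ 0 → d ∣ k) (m : ℕ) :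
    ∀ j, PowerSeries.coeff j (PowerSeries.mk p ^ m) ≠ 0 → d ∣ j := by
  induction m with
  | zero =>
    intro j hj
    by_cases h : j = 0
    · simp [h]
    · simp [PowerSeries.coeff_one, h] at hj
  | succ m ih =>
    intro j hj
    rw [pow_succ, PowerSeries.coeff_mul] at hj
    obtain ⟨kl, h1, h2⟩ := Finset.exists_ne_zero_of_sum_ne_zero hj
    rw [Finset.HasAntidiagonal.mem_antidiagonal] at h1
    rw [PowerSeries.coeff_mk] at h2
    rw [← h1]
    exact dvd_add (ih _ (left_ne_zero_of_mul h2)) (hp _ (right_ne_zero_of_mul h2))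

lemma nct_int_exp (d : ℕ) (hd : 0 < d) (r : ℤ) :
    ∫ t in (-(Real.pi / d))..(Real.pi / d), Complex.exp (Complex.I * ((t * (d * r : ℝ) : ℝ) : ℂ)) =
      if r = 0 then ((2 * Real.pi / d : ℝ) : ℂ) else 0 := by
  have hdc : (d : ℂ) ≠ 0 := by exact_mod_cast hd.ne'
  split_ifs with h
  · subst h
    simp
    ring
  · have hr : (r : ℂ) ≠ 0 := by exact_mod_cast h
    have h1 := integral_exp_mul_complex (a := -(Real.pi / d)) (b := Real.pi / d)
      (c := Complex.I * d * r) (mul_ne_zero (mul_ne_zero Complex.I_ne_zero hdc) hr)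
    have e : ∀ t : ℝ, Complex.I * ((t * (d * r : ℝ) : ℝ) : ℂ) = Complex.I * d * r * t := by
      intro t; push_cast; ring
    simp_rw [e]
    rw [h1]
    have e2 : Complex.exp (Complex.I * d * r * ((Real.pi / d : ℝ) : ℂ)) =
        Complex.exp (Complex.I * d * r * ((-(Real.pi / d) : ℝ) : ℂ)) := by
      rw [Complex.exp_eq_exp_iff_exists_int]
      refine ⟨r, ?_⟩
      push_cast
      field_simp
      ring
    rw [e2, sub_self, zero_div]

/-- Fourier inversion on a lattice. -/
lemma nct_fourier (c : ℕ → ℝ) (d : ℕ) (hd : 0 < d) (hc : Summable fun j => ‖c j‖)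
    (hs : ∀ j, c j ≠ 0 → d ∣ j) (j : ℕ) (hj : d ∣ j) :
    ∫ t in (-(Real.pi / d))..(Real.pi / d), Complex.exp (Complex.I * ((t * (-(j : ℝ)) : ℝ) : ℂ)) *
      ∑' l, (c l : ℂ) * Complex.exp (Complex.I * (t : ℂ)) ^ l = ((2 * Real.pi / d * c j : ℝ) : ℂ) := by
  have key := intervalIntegral.hasSum_integral_of_dominated_convergence (μ := MeasureTheory.volume)
    (a := -(Real.pi / d)) (b := Real.pi / d)
    (F := fun (l : ℕ) (t : ℝ) => Complex.exp (Complex.I * ((t * (-(j : ℝ)) : ℝ) : ℂ)) *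
      ((c l : ℂ) * Complex.exp (Complex.I * (t : ℂ)) ^ l))
    (f := fun t : ℝ => Complex.exp (Complex.I * ((t * (-(j : ℝ)) : ℝ) : ℂ)) *
      ∑' l, (c l : ℂ) * Complex.exp (Complex.I * (t : ℂ)) ^ l)
    (fun l _ => ‖c l‖) ?_ ?_ ?_ ?_ ?_
  · rw [← key.tsum_eq]
    rw [tsum_eq_single j]
    · have : ∀ t : ℝ, Complex.exp (Complex.I * ((t * (-(j : ℝ)) : ℝ) : ℂ)) *
        ((c j : ℂ) * Complex.exp (Complex.I * (t : ℂ)) ^ j) = (c j : ℂ) := by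
        intro t
        rw [mul_left_comm, ← Complex.exp_nat_mul, ← Complex.exp_add]
        have : Complex.I * ((t * (-(j : ℝ)) : ℝ) : ℂ) + (j : ℂ) * (Complex.I * (t : ℂ)) = 0 := by
          push_cast; ring
        rw [this]; simp
      simp_rw [this]
      rw [intervalIntegral.integral_const]
      rw [Complex.real_smul]
      push_cast
      ring
    · intro l hl
      by_cases hcl : c l = 0
      · simp [hcl]
      obtain ⟨a, ha⟩ := hs l hcl
      obtain ⟨b, hb⟩ := hj
      have hab : (a : ℤ) - b ≠ 0 := by
        intro h
        apply hl
        have : a = b := by omega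
        rw [ha, hb, this]
      have : ∀ t : ℝ, Complex.exp (Complex.I * ((t * (-(j : ℝ)) : ℝ) : ℂ)) *
        ((c l : ℂ) * Complex.exp (Complex.I * (t : ℂ)) ^ l) = (c l : ℂ) *
          Complex.exp (Complex.I * ((t * (d * ((a - b : ℤ) : ℝ) : ℝ) : ℝ) : ℂ)) := by
        intro t
        rw [mul_left_comm, ← Complex.exp_nat_mul, ← Complex.exp_add]
        congr 2
        rw [ha, hb]
        push_cast
        ring
      simp_rw [this]
      rw [intervalIntegral.integral_const_mul, nct_int_exp d hd, if_neg hab, mul_zero]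
  · intro l
    apply Continuous.aestronglyMeasurable
    fun_prop
  · intro l
    refine Eventually.of_forall fun t _ => ?_
    rw [norm_mul, nct_norm_expI, one_mul, norm_mul, norm_pow, nct_norm_expI, one_pow, mul_one,
      Complex.norm_real]
  · exact Eventually.of_forall fun t _ => hc
  · exact intervalIntegrable_const
  · refine Eventually.of_forall fun t _ => ?_
    apply HasSum.mul_left
    apply Summable.hasSum
    apply Summable.of_norm
    simpa [norm_mul, norm_pow, nct_norm_expI] using hc

/-- The truncated characteristic function. -/
noncomputable def nctH (p : ℕ → ℝ) (d : ℕ) (t : ℝ) : ℂ :=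
  (Ioc (-(Real.pi / d)) (Real.pi / d)).indicator (nctXi p) t

/-- The Fourier integral. -/
noncomputable def nctI (p : ℕ → ℝ) (d m k : ℕ) : ℂ :=
  ∫ t : ℝ, Complex.exp (Complex.I * ((t * (k : ℝ) : ℝ) : ℂ)) * nctH p d t ^ m

lemma nctXi_eq (p : ℕ → ℝ) (t : ℝ) : nctXi p t =
    Complex.exp (Complex.I * ((-t : ℝ) : ℂ)) *
      ∑' k, (p k : ℂ) * Complex.exp (Complex.I * (t : ℂ)) ^ k := by
  rw [nctXi, ← tsum_mul_left]
  congr 1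
  ext k
  rw [nctXt, mul_left_comm, ← Complex.exp_nat_mul, ← Complex.exp_add]
  congr 2
  push_cast
  ring

lemma nct_inversion {p : ℕ → ℝ} {d : ℕ} {v : ℝ} (h : NctP p d v) (m k : ℕ) (hm : 1 ≤ m)
    (hk : k ≤ m) (hd : d ∣ m - k) :
    ((2 * Real.pi / d * PowerSeries.coeff (m - k) (PowerSeries.mk p ^ m) : ℝ) : ℂ) =
      nctI p d m k := by
  have hdp : (0 : ℝ) < d := by exact_mod_cast h.dpos
  have hp : Summable fun k => ‖p k‖ := h.sum.summable.norm
  have hc := (nct_pow_sum p hp 1 (by simp) m).1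
  simp only [one_pow, mul_one, Complex.norm_real] at hc
  rw [← nct_fourier (fun j => PowerSeries.coeff j (PowerSeries.mk p ^ m)) d h.dpos hc
    (nct_pow_supp p d h.ddvd m) (m - k) hd]
  rw [intervalIntegral.integral_of_le (by have := Real.pi_pos; have : 0 < Real.pi / d := by positivity
                                          linarith), nctI,
    ← MeasureTheory.integral_indicator measurableSet_Ioc]
  congr 1
  ext t
  by_cases ht : t ∈ Ioc (-(Real.pi / d)) (Real.pi / d)
  · rw [indicator_of_mem ht, nctH, indicator_of_mem ht, nctXi_eq, mul_pow,
      (nct_pow_sum p hp _ (nct_norm_expI t) m).2.tsum_eq, ← mul_assoc, ← Complex.exp_nat_mul,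
      ← Complex.exp_add]
    congr 2
    rw [Nat.cast_sub hk]
    push_cast
    ring
  · rw [indicator_of_notMem ht, nctH, indicator_of_notMem ht, zero_pow (by omega), mul_zero]

lemma nctH_bound {p : ℕ → ℝ} {d : ℕ} {v : ℝ} (h : NctP p d v) :
    ∃ c > 0, ∀ t : ℝ, ‖nctH p d t‖ ≤ Real.exp (-c * t ^ 2) := by
  obtain ⟨c, hc, hb⟩ := nctXi_gauss h
  refine ⟨c, hc, fun t => ?_⟩
  by_cases ht : t ∈ Ioc (-(Real.pi / d)) (Real.pi / d)
  · rw [nctH, indicator_of_mem ht]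
    exact hb t (abs_le.2 ⟨ht.1.le, ht.2⟩)
  · rw [nctH, indicator_of_notMem ht, norm_zero]
    positivity

lemma nctH_meas {p : ℕ → ℝ} {d : ℕ} {v : ℝ} (h : NctP p d v) : Measurable (nctH p d) :=
  (nctXi_continuous h).measurable.indicator measurableSet_Ioc

lemma nctI_bound {p : ℕ → ℝ} {d : ℕ} {v : ℝ} (h : NctP p d v) :
    ∃ C : ℝ, ∀ m k : ℕ, 1 ≤ m → Real.sqrt m * ‖nctI p d m k‖ ≤ C := by
  obtain ⟨c, hc, hb⟩ := nctH_bound h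
  refine ⟨Real.sqrt (Real.pi / c), fun m k hm => ?_⟩
  have hm' : (0 : ℝ) < m := by exact_mod_cast hm
  have h1 : ‖nctI p d m k‖ ≤ ∫ t : ℝ, Real.exp (-(c * m) * t ^ 2) := by
    apply MeasureTheory.norm_integral_le_of_norm_le
    · exact integrable_exp_neg_mul_sq (by positivity)
    · refine Eventually.of_forall fun t => ?_
      rw [norm_mul, nct_norm_expI, one_mul, norm_pow]
      refine (pow_le_pow_left₀ (norm_nonneg _) (hb t) m).trans (le_of_eq ?_)
      rw [← Real.exp_nat_mul]
      congr 1
      ring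
  rw [integral_gaussian] at h1
  calc Real.sqrt m * ‖nctI p d m k‖ ≤ Real.sqrt m * Real.sqrt (Real.pi / (c * m)) := by gcongr
    _ = Real.sqrt (Real.pi / c) := by
      rw [← Real.sqrt_mul hm'.le]
      congr 1
      field_simp

lemma nctI_tendsto {p : ℕ → ℝ} {d : ℕ} {v : ℝ} (h : NctP p d v) (k : ℕ) :
    Tendsto (fun m : ℕ => ((Real.sqrt m : ℝ) : ℂ) * nctI p d m k) atTop
      (𝓝 ((Real.sqrt (2 * Real.pi / v) : ℝ) : ℂ)) := by
  obtain ⟨c, hc, hb⟩ := nctH_bound h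
  have hdp : (0 : ℝ) < d := by exact_mod_cast h.dpos
  have hv := h.vpos
  have hpi := Real.pi_pos
  have hsq : Tendsto (fun m : ℕ => Real.sqrt m) atTop atTop :=
    Real.tendsto_sqrt_atTop.comp tendsto_natCast_atTop_atTop
  have e1 : ((Real.sqrt (2 * Real.pi / v) : ℝ) : ℂ) =
      ∫ u : ℝ, ((Real.exp (-(v / 2) * u ^ 2) : ℝ) : ℂ) := by
    rw [integral_complex_ofReal, integral_gaussian]
    congr 2
    field_simp
  have key : Tendsto (fun m : ℕ => ∫ u : ℝ,
      Complex.exp (Complex.I * ((u / Real.sqrt m * (k : ℝ) : ℝ) : ℂ)) * nctH p d (u / Real.sqrt m) ^ m)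
      atTop (𝓝 (∫ u : ℝ, ((Real.exp (-(v / 2) * u ^ 2) : ℝ) : ℂ))) := by
    apply MeasureTheory.tendsto_integral_filter_of_dominated_convergence
      (bound := fun u => Real.exp (-c * u ^ 2))
    · refine Eventually.of_forall fun m => ?_
      apply Measurable.aestronglyMeasurable
      apply Measurable.mul
      · apply Continuous.measurable
        fun_prop
      · exact ((nctH_meas h).comp (measurable_id.div_const _)).pow_const m
    · filter_upwards [eventually_ge_atTop 1] with m hm
      have hm' : (0 : ℝ) < m := by exact_mod_cast hm
      refine Eventually.of_forall fun u => ?_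
      rw [norm_mul, nct_norm_expI, one_mul, norm_pow]
      refine (pow_le_pow_left₀ (norm_nonneg _) (hb _) m).trans (le_of_eq ?_)
      rw [← Real.exp_nat_mul, div_pow, Real.sq_sqrt hm'.le]
      congr 1
      field_simp
    · exact integrable_exp_neg_mul_sq hc
    · have hae : ∀ᵐ u : ℝ, u ≠ 0 := by
        rw [MeasureTheory.ae_iff]
        simp
      filter_upwards [hae] with u hu
      have ht0 : Tendsto (fun m : ℕ => u / Real.sqrt m) atTop (𝓝 0) := hsq.const_div_atTop u
      have ht1 : Tendsto (fun m : ℕ => u / Real.sqrt m) atTop (𝓝[≠] 0) := by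
        rw [tendsto_nhdsWithin_iff]
        refine ⟨ht0, ?_⟩
        filter_upwards [eventually_ge_atTop 1] with m hm
        have hm' : (0 : ℝ) < m := by exact_mod_cast hm
        have : Real.sqrt m ≠ 0 := by positivity
        exact div_ne_zero hu this
      have l1 : Tendsto (fun m : ℕ => Complex.exp (Complex.I * ((u / Real.sqrt m * (k : ℝ) : ℝ) : ℂ)))
          atTop (𝓝 1) := by
        have hcont : Continuous (fun t : ℝ => Complex.exp (Complex.I * ((t * (k : ℝ) : ℝ) : ℂ))) := by
          fun_prop
        have := (hcont.tendsto 0).comp ht0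
        simpa [Function.comp_def] using this
      have l2 : Tendsto (fun m : ℕ => (1 + (nctXi p (u / Real.sqrt m) - 1)) ^ m) atTop
          (𝓝 (Complex.exp (((-(v / 2) * u ^ 2 : ℝ)) : ℂ))) := by
        apply Complex.tendsto_one_add_pow_exp_of_tendsto
        have l3 := ((nctXi_taylor h).comp ht1).const_mul ((u : ℂ) ^ 2)
        have e2 : (u : ℂ) ^ 2 * (-(v : ℂ) / 2) = ((-(v / 2) * u ^ 2 : ℝ) : ℂ) := by
          push_cast; ring
        rw [e2] at l3
        refine l3.congr' ?_
        filter_upwards [eventually_ge_atTop 1] with m hm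
        have hm' : (0 : ℝ) < m := by exact_mod_cast hm
        have huc : (u : ℂ) ≠ 0 := by exact_mod_cast hu
        have hs : ((Real.sqrt m : ℝ) : ℂ) ^ 2 = m := by
          rw [← Complex.ofReal_pow, Real.sq_sqrt hm'.le]; simp
        have hmc : (m : ℂ) ≠ 0 := by exact_mod_cast hm'.ne'
        simp only [Function.comp]
        rw [Complex.ofReal_div, div_pow, hs]
        field_simp
      have l4 : Tendsto (fun m : ℕ => nctH p d (u / Real.sqrt m) ^ m) atTop
          (𝓝 (Complex.exp (((-(v / 2) * u ^ 2 : ℝ)) : ℂ))) := by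
        refine l2.congr' ?_
        have hpd : 0 < Real.pi / d := by positivity
        filter_upwards [ht0 (Ioo_mem_nhds (neg_lt_zero.2 hpd) hpd)] with m hm
        rw [nctH, indicator_of_mem (Ioo_subset_Ioc_self hm)]
        ring_nf
      have := l1.mul l4
      rw [one_mul, ← Complex.ofReal_exp] at this
      exact this
  rw [e1]
  refine key.congr fun m => ?_
  have := MeasureTheory.Measure.integral_comp_div (fun t : ℝ =>
    Complex.exp (Complex.I * ((t * (k : ℝ) : ℝ) : ℂ)) * nctH p d t ^ m) (Real.sqrt m)
  rw [this, abs_of_nonneg (Real.sqrt_nonneg _), Complex.real_smul, nctI]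


/-! ### Part F -/
open Filter Set
open scoped Topology

lemma nct_hasSum_congr {f g : ℕ → ℝ} {a : ℝ} (h : ∀ k, f k = g k) (hg : HasSum g a) :
    HasSum f a := by
  rw [funext h]
  exact hg

lemma nct_ind {P : ℕ → Prop} [DecidablePred P] (f : ℕ → ℝ) :
    {k : ℕ | P k}.indicator f = fun k => if P k then f k else 0 := by
  ext k
  by_cases h : P k <;> simp [h]

open Classical in
/-- The step distribution. -/
noncomputable def nctQ (A : Set ℕ) (b S1 : ℝ) (k : ℕ) : ℝ :=
  (if k + 1 ∈ A then (k : ℝ) + 1 else 0) * b ^ k / S1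

lemma nctQ_coeff (A : Set ℕ) (b S1 : ℝ) (m j : ℕ) :
    PowerSeries.coeff j (PowerSeries.mk (nctQ A b S1) ^ m) =
      PowerSeries.coeff j (nctW A ^ m) * b ^ j / S1 ^ m := by
  have e : PowerSeries.mk (nctQ A b S1) =
      PowerSeries.C (1 / S1) * PowerSeries.rescale b (nctW A) := by
    ext k
    rw [PowerSeries.coeff_C_mul, PowerSeries.coeff_rescale, nctW, PowerSeries.coeff_mk,
      PowerSeries.coeff_mk, nctQ]
    ring
  rw [e, mul_pow, ← map_pow, ← map_pow, PowerSeries.coeff_C_mul, PowerSeries.coeff_rescale]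
  rw [div_pow, one_pow]
  ring

lemma nct_S1_pos
    (A : Set ℕ)
    (hA1 : 1 ∈ A)
    (b : ℝ)
    (hb : 0 < b)
    (S1 : ℝ)
    (hS1 : HasSum ({k : ℕ | k + 1 ∈ A}.indicator fun k => ((k : ℝ) + 1) * b ^ k) S1) : 0 < S1 := by
  classical
  rw [nct_ind] at hS1
  have h1 := hS1.tsum_eq
  rw [← h1]
  apply hS1.summable.tsum_pos (i := 0)
  · intro k
    split_ifs <;> positivity
  · simp [hA1]

lemma nct_S2_pos
    (A : Set ℕ)
    (hA1 : 1 ∈ A)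
    (b : ℝ)
    (hb : 0 < b)
    (S2 : ℝ)
    (hS2 : HasSum (A.indicator fun k => (k : ℝ) * b ^ k) S2) : 0 < S2 := by
  classical
  rw [← hS2.tsum_eq]
  apply hS2.summable.tsum_pos (i := 1)
  · intro k
    apply indicator_nonneg
    intro k _
    positivity
  · simp [hA1, hb]

lemma nct_S4_eq
    (A : Set ℕ)
    (b : ℝ)
    (hb : 0 < b)
    (S1 : ℝ)
    (S4 : ℝ)
    (hS1 : HasSum ({k : ℕ | k + 1 ∈ A}.indicator fun k => ((k : ℝ) + 1) * b ^ k) S1)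
    (hS4 : HasSum ({k : ℕ | k + 1 ∈ A}.indicator
      fun k => ((k : ℝ) + 1) * b ^ ((k : ℤ) - 1)) S4) : S4 = S1 / b := by
  refine hS4.unique ?_
  refine nct_hasSum_congr (fun k => ?_) (hS1.div_const b)
  by_cases h : k + 1 ∈ A
  · simp only [indicator, mem_ofPred_eq, h, if_true]
    rw [zpow_sub_one₀ hb.ne']
    simp
    ring
  · simp [indicator, h]

lemma nct_d_pos
    (A : Set ℕ)
    (hA1 : 1 ∈ A)
    (hApos : ∀ a ∈ A, 1 ≤ a)
    (hne1 : A ≠ {1})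
    (d : ℕ)
    (hd_dvd : ∀ a ∈ A, d ∣ (a - 1)) : 0 < d := by
  rcases Nat.eq_zero_or_pos d with rfl | h
  · exfalso
    apply hne1
    ext a
    constructor
    · intro ha
      have h1 := hd_dvd a ha
      have h2 := hApos a ha
      rw [zero_dvd_iff] at h1
      simp; omega
    · rintro rfl; exact hA1
  · exact h

lemma nct_dist
    (A : Set ℕ)
    (hA1 : 1 ∈ A)
    (hApos : ∀ a ∈ A, 1 ≤ a)
    (hne1 : A ≠ {1})
    (b : ℝ)
    (hb : 0 < b)
    (hcrit : HasSum ({k : ℕ | k + 1 ∈ A}.indicator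
      fun k => ((k : ℝ) + 1) * ((k : ℝ) - 1) * b ^ k) 0)
    (d : ℕ)
    (hd_dvd : ∀ a ∈ A, d ∣ (a - 1))
    (hd_gcd : ∀ e : ℕ, (∀ a ∈ A, e ∣ (a - 1)) → e ∣ d)
    (S1 : ℝ)
    (S3 : ℝ)
    (hS1 : HasSum ({k : ℕ | k + 1 ∈ A}.indicator fun k => ((k : ℝ) + 1) * b ^ k) S1)
    (hS3 : HasSum ({k : ℕ | k + 1 ∈ A}.indicator
      fun k => ((k : ℝ) + 1) * ((k : ℝ) ^ 2 - 1) * b ^ k) S3) : NctP (nctQ A b S1) d (S3 / S1) := by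
  classical
  have hS1p := nct_S1_pos A hA1 b hb S1 hS1
  rw [nct_ind] at hcrit hS1 hS3
  have hvar : HasSum (fun k : ℕ => ((k : ℝ) - 1) ^ 2 * nctQ A b S1 k) (S3 / S1) := by
    have := (hS3.sub (hcrit.mul_left 2)).div_const S1
    rw [mul_zero, sub_zero] at this
    refine nct_hasSum_congr (fun k => ?_) (this)
    unfold nctQ
    split_ifs <;> ring
  have hnn : ∀ k, 0 ≤ nctQ A b S1 k := by
    intro k
    unfold nctQ
    split_ifs <;> positivity
  have h0 : 0 < nctQ A b S1 0 := by
    simp [nctQ, hA1, hS1p]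
  refine ⟨hnn, ?_, ?_, hvar, ?_, h0, ?_, ?_, nct_d_pos A hA1 hApos hne1 d hd_dvd⟩
  · have := hS1.div_const S1
    rw [div_self hS1p.ne'] at this
    refine nct_hasSum_congr (fun k => ?_) (this)
    unfold nctQ
    split_ifs <;> ring
  · have := hcrit.div_const S1
    rw [zero_div] at this
    refine nct_hasSum_congr (fun k => ?_) (this)
    unfold nctQ
    split_ifs <;> ring
  · rw [← hvar.tsum_eq]
    apply hvar.summable.tsum_pos (i := 0)
    · intro k
      exact mul_nonneg (sq_nonneg _) (hnn k)
    · simpa using h0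
  · intro k hk
    have : k + 1 ∈ A := by
      by_contra h
      simp [nctQ, h] at hk
    simpa using hd_dvd _ this
  · intro e he
    apply hd_gcd
    intro a ha
    apply he
    have h1 := hApos a ha
    unfold nctQ
    rw [Nat.sub_add_cancel h1, if_pos ha]
    positivity

open Classical in
lemma nct_tannery
    (A : Set ℕ)
    (hA1 : 1 ∈ A)
    (hApos : ∀ a ∈ A, 1 ≤ a)
    (hne1 : A ≠ {1})
    (b : ℝ)
    (hb : 0 < b)
    (hcrit : HasSum ({k : ℕ | k + 1 ∈ A}.indicator
      fun k => ((k : ℝ) + 1) * ((k : ℝ) - 1) * b ^ k) 0)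
    (d : ℕ)
    (hd_dvd : ∀ a ∈ A, d ∣ (a - 1))
    (hd_gcd : ∀ e : ℕ, (∀ a ∈ A, e ∣ (a - 1)) → e ∣ d)
    (S1 : ℝ)
    (S2 : ℝ)
    (S3 : ℝ)
    (hS1 : HasSum ({k : ℕ | k + 1 ∈ A}.indicator fun k => ((k : ℝ) + 1) * b ^ k) S1)
    (hS2 : HasSum (A.indicator fun k => (k : ℝ) * b ^ k) S2)
    (hS3 : HasSum ({k : ℕ | k + 1 ∈ A}.indicator
      fun k => ((k : ℝ) + 1) * ((k : ℝ) ^ 2 - 1) * b ^ k) S3) : Tendsto (fun m : ℕ => ∑ k ∈ Finset.range (m + 1), if k ∈ A then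
      (k : ℝ) * b ^ k * (Real.sqrt m * (nctI (nctQ A b S1) d m k).re) else 0) atTop
    (𝓝 (S2 * Real.sqrt (2 * Real.pi / (S3 / S1)))) := by
  have hP := nct_dist A hA1 hApos hne1 b hb hcrit d hd_dvd hd_gcd S1 S3 hS1 hS3
  obtain ⟨C, hC⟩ := nctI_bound hP
  have key := tendsto_tsum_of_dominated_convergence (𝓕 := (atTop : Filter ℕ))
    (f := fun (m k : ℕ) => if k < m + 1 then (if k ∈ A then
      (k : ℝ) * b ^ k * (Real.sqrt m * (nctI (nctQ A b S1) d m k).re) else 0) else 0)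
    (g := fun k => A.indicator (fun k => (k : ℝ) * b ^ k) k * Real.sqrt (2 * Real.pi / (S3 / S1)))
    (bound := fun k => A.indicator (fun k => (k : ℝ) * b ^ k) k * C) (hS2.summable.mul_right C)
    ?_ ?_
  · rw [(hS2.mul_right _).tsum_eq] at key
    refine key.congr fun m => ?_
    rw [tsum_eq_sum (s := Finset.range (m + 1))]
    · apply Finset.sum_congr rfl
      intro k hk
      rw [if_pos (Finset.mem_range.1 hk)]
    · intro k hk
      rw [if_neg (by simpa using hk)]
  · intro k
    have h1 := (Complex.continuous_re.tendsto _).comp (nctI_tendsto hP k)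
    simp only [Function.comp_def, Complex.re_ofReal_mul, Complex.ofReal_re] at h1
    have h2 := h1.const_mul (A.indicator (fun k => (k : ℝ) * b ^ k) k)
    refine h2.congr' ?_
    filter_upwards [eventually_ge_atTop k] with m hm
    rw [if_pos (by omega)]
    by_cases h : k ∈ A <;> simp [h]
  · filter_upwards [eventually_ge_atTop 1] with m hm k
    have h1 := hC m k hm
    have hC0 : 0 ≤ C := le_trans (by positivity) h1
    split_ifs with h2 h3
    · rw [indicator_of_mem h3, norm_mul, Real.norm_of_nonneg (by positivity : 0 ≤ (k : ℝ) * b ^ k)]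
      apply mul_le_mul_of_nonneg_left _ (by positivity)
      rw [norm_mul, Real.norm_of_nonneg (Real.sqrt_nonneg _), Real.norm_eq_abs]
      refine le_trans ?_ h1
      apply mul_le_mul_of_nonneg_left (Complex.abs_re_le_norm _) (Real.sqrt_nonneg _)
    · simp [h3]
    · rw [norm_zero]
      apply mul_nonneg _ hC0
      apply indicator_nonneg
      intro k _
      positivity

lemma nct_dvd
    (A : Set ℕ)
    (hApos : ∀ a ∈ A, 1 ≤ a)
    (d : ℕ)
    (hd_dvd : ∀ a ∈ A, d ∣ (a - 1)) (m : ℕ) (hm : 1 ≤ m)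
    (hN : Nat.card {θ : NCTree (m + 1) // ∀ v : Fin (m + 1), ncDeg (m + 1) θ v ∈ A} ≠ 0) :
    d ∣ m - 1 := by
  classical
  have h1 := nct_count A m
  have h2 : (m : ℝ) * (Nat.card {θ : NCTree (m + 1) // ∀ v : Fin (m + 1), ncDeg (m + 1) θ v ∈ A} : ℝ)
      ≠ 0 := mul_ne_zero (by positivity) (by exact_mod_cast hN)
  rw [h1] at h2
  obtain ⟨k, hk, h3⟩ := Finset.exists_ne_zero_of_sum_ne_zero h2
  rw [Finset.mem_range] at hk
  have hkA : k ∈ A := by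
    by_contra h
    simp [h] at h3
  rw [if_pos hkA] at h3
  have h4 : d ∣ m - k := by
    refine nct_pow_supp _ d ?_ m _ (right_ne_zero_of_mul h3)
    intro j hj
    have : j + 1 ∈ A := by
      by_contra h
      simp [h] at hj
    simpa using hd_dvd _ this
  have h5 := hd_dvd k hkA
  have h6 := hApos k hkA
  have : m - 1 = (m - k) + (k - 1) := by omega
  rw [this]
  exact dvd_add h4 h5

open Classical in
lemma nct_exact
    (A : Set ℕ)
    (hA1 : 1 ∈ A)
    (hApos : ∀ a ∈ A, 1 ≤ a)
    (hne1 : A ≠ {1})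
    (b : ℝ)
    (hb : 0 < b)
    (hcrit : HasSum ({k : ℕ | k + 1 ∈ A}.indicator
      fun k => ((k : ℝ) + 1) * ((k : ℝ) - 1) * b ^ k) 0)
    (d : ℕ)
    (hd_dvd : ∀ a ∈ A, d ∣ (a - 1))
    (hd_gcd : ∀ e : ℕ, (∀ a ∈ A, e ∣ (a - 1)) → e ∣ d)
    (S1 : ℝ)
    (S3 : ℝ)
    (S4 : ℝ)
    (hS1 : HasSum ({k : ℕ | k + 1 ∈ A}.indicator fun k => ((k : ℝ) + 1) * b ^ k) S1)
    (hS3 : HasSum ({k : ℕ | k + 1 ∈ A}.indicator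
      fun k => ((k : ℝ) + 1) * ((k : ℝ) ^ 2 - 1) * b ^ k) S3)
    (hS4 : HasSum ({k : ℕ | k + 1 ∈ A}.indicator
      fun k => ((k : ℝ) + 1) * b ^ ((k : ℤ) - 1)) S4) (m : ℕ) (hm : 1 ≤ m) (hdm : d ∣ m - 1) :
    (m : ℝ) * (Nat.card {θ : NCTree (m + 1) // ∀ v : Fin (m + 1), ncDeg (m + 1) θ v ∈ A} : ℝ) *
        Real.sqrt m =
      S4 ^ m * (d / (2 * Real.pi)) * ∑ k ∈ Finset.range (m + 1), if k ∈ A then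
      (k : ℝ) * b ^ k * (Real.sqrt m * (nctI (nctQ A b S1) d m k).re) else 0 := by
  have hP := nct_dist A hA1 hApos hne1 b hb hcrit d hd_dvd hd_gcd S1 S3 hS1 hS3
  have hS1p := nct_S1_pos A hA1 b hb S1 hS1
  have hdp : (0 : ℝ) < d := by exact_mod_cast hP.dpos
  have hpi := Real.pi_pos
  rw [nct_count, nct_S4_eq A b hb S1 S4 hS1 hS4, Finset.sum_mul, Finset.mul_sum]
  apply Finset.sum_congr rfl
  intro k hk
  rw [Finset.mem_range] at hk
  split_ifs with hkA
  · have h6 := hApos k hkA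
    have h5 := hd_dvd k hkA
    have h7 : d ∣ m - k := by
      have : m - k = (m - 1) - (k - 1) := by omega
      rw [this]
      exact Nat.dvd_sub hdm h5
    have h8 := congrArg Complex.re (nct_inversion hP m k hm (by omega) h7)
    rw [Complex.ofReal_re, nctQ_coeff] at h8
    rw [← h8, div_pow]
    have hbm : b ^ m = b ^ (m - k) * b ^ k := by rw [← pow_add]; congr 1; omega
    rw [hbm]
    field_simp
  · simp

theorem nct_final (A : Set ℕ) (hA1 : 1 ∈ A)
    (hApos : ∀ a ∈ A, 1 ≤ a) (hne1 : A ≠ {1}) (hne12 : A ≠ ({1, 2} : Set ℕ))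
    (b : ℝ) (hb : 0 < b)
    (hcrit : HasSum ({k : ℕ | k + 1 ∈ A}.indicator
      fun k => ((k : ℝ) + 1) * ((k : ℝ) - 1) * b ^ k) 0)
    (d : ℕ) (hd_dvd : ∀ a ∈ A, d ∣ (a - 1))
    (hd_gcd : ∀ e : ℕ, (∀ a ∈ A, e ∣ (a - 1)) → e ∣ d)
    (S1 S2 S3 S4 : ℝ)
    (hS1 : HasSum ({k : ℕ | k + 1 ∈ A}.indicator fun k => ((k : ℝ) + 1) * b ^ k) S1)
    (hS2 : HasSum (A.indicator fun k => (k : ℝ) * b ^ k) S2)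
    (hS3 : HasSum ({k : ℕ | k + 1 ∈ A}.indicator
      fun k => ((k : ℝ) + 1) * ((k : ℝ) ^ 2 - 1) * b ^ k) S3)
    (hS4 : HasSum ({k : ℕ | k + 1 ∈ A}.indicator
      fun k => ((k : ℝ) + 1) * b ^ ((k : ℤ) - 1)) S4) :
    Filter.Tendsto
      (fun n : ℕ => (Nat.card {θ : NCTree n // ∀ v : Fin n, ncDeg n θ v ∈ A} : ℝ) /
        ((d : ℝ) * Real.sqrt (S1 / (2 * Real.pi * S3)) * S2 *
          S4 ^ (n - 1) * (n : ℝ) ^ (-(3 : ℝ) / 2)))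
      (Filter.atTop ⊓ Filter.principal
        {n : ℕ | Nat.card {θ : NCTree n // ∀ v : Fin n, ncDeg n θ v ∈ A} ≠ 0})
      (𝓝 1) := by
  classical
  have hP := nct_dist A hA1 hApos hne1 b hb hcrit d hd_dvd hd_gcd S1 S3 hS1 hS3
  have hS1p := nct_S1_pos A hA1 b hb S1 hS1
  have hS2p := nct_S2_pos A hA1 b hb S2 hS2
  have hS4e := nct_S4_eq A b hb S1 S4 hS1 hS4
  have hS4p : 0 < S4 := by rw [hS4e]; positivity
  have hS3p : 0 < S3 := by
    have := hP.vpos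
    rw [div_pos_iff_of_pos_right hS1p] at this
    exact this
  have hdp : (0 : ℝ) < d := by exact_mod_cast hP.dpos
  have hpi := Real.pi_pos
  set K : ℝ := (d : ℝ) * Real.sqrt (S1 / (2 * Real.pi * S3)) * S2 with hK
  have hKp : 0 < K := by positivity
  set Z : ℕ → ℝ := fun m : ℕ => ∑ k ∈ Finset.range (m + 1), if k ∈ A then
      (k : ℝ) * b ^ k * (Real.sqrt m * (nctI (nctQ A b S1) d m k).re) else 0 with hZ
  have hT := nct_tannery A hA1 hApos hne1 b hb hcrit d hd_dvd hd_gcd S1 S2 S3 hS1 hS2 hS3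
  have hT1 : Tendsto (fun m => d / (2 * Real.pi) * Z m / K) atTop (𝓝 1) := by
    have h1 := (hT.const_mul (d / (2 * Real.pi))).div_const K
    have h2 : d / (2 * Real.pi) * (S2 * Real.sqrt (2 * Real.pi / (S3 / S1))) / K = 1 := by
      have h3 : Real.sqrt (2 * Real.pi / (S3 / S1)) =
          2 * Real.pi * Real.sqrt (S1 / (2 * Real.pi * S3)) := by
        have : 2 * Real.pi / (S3 / S1) = (2 * Real.pi) ^ 2 * (S1 / (2 * Real.pi * S3)) := by
          field_simp
        rw [this, Real.sqrt_mul (by positivity), Real.sqrt_sq (by positivity)]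
      have h4 : 0 < Real.sqrt (S1 / (2 * Real.pi * S3)) := by positivity
      rw [h3, hK]
      field_simp
    rw [h2] at h1
    exact h1
  have hT2 : Tendsto (fun m : ℕ => (((m : ℝ) + 1) / m) ^ ((3 : ℝ) / 2)) atTop (𝓝 1) := by
    have h1 : Tendsto (fun m : ℕ => ((m : ℝ) + 1) / m) atTop (𝓝 1) := by
      have h2 : Tendsto (fun m : ℕ => 1 + 1 / (m : ℝ)) atTop (𝓝 (1 + 0)) :=
        tendsto_const_nhds.add tendsto_one_div_atTop_nhds_zero_nat
      rw [add_zero] at h2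
      refine h2.congr' ?_
      filter_upwards [eventually_ge_atTop 1] with m hm
      have : (0 : ℝ) < m := by exact_mod_cast hm
      field_simp
    have := h1.rpow_const (p := (3 : ℝ) / 2) (Or.inl one_ne_zero)
    simpa using this
  have hT3 := hT1.mul hT2
  rw [one_mul] at hT3
  have hT4 := (hT3.comp (tendsto_sub_atTop_nat 1)).mono_left
    (inf_le_left : Filter.atTop ⊓ Filter.principal
        {n : ℕ | Nat.card {θ : NCTree n // ∀ v : Fin n, ncDeg n θ v ∈ A} ≠ 0} ≤ Filter.atTop)
  refine hT4.congr' ?_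
  rw [Filter.EventuallyEq, Filter.eventually_inf_principal]
  filter_upwards [eventually_ge_atTop 2] with n hn hN
  obtain ⟨m, rfl⟩ : ∃ m, n = m + 1 := ⟨n - 1, by omega⟩
  have hm : 1 ≤ m := by omega
  have hmp : (0 : ℝ) < m := by exact_mod_cast hm
  have hdm := nct_dvd A hApos d hd_dvd m hm hN
  have hex := nct_exact A hA1 hApos hne1 b hb hcrit d hd_dvd hd_gcd S1 S3 S4 hS1 hS3 hS4 m hm hdm
  simp only [Function.comp, Nat.add_sub_cancel]
  have e1 : (m : ℝ) ^ ((3 : ℝ) / 2) = m * Real.sqrt m := by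
    rw [show (3 : ℝ) / 2 = 1 + 1 / 2 by norm_num, Real.rpow_add hmp, Real.rpow_one,
      Real.sqrt_eq_rpow]
  have e2 : ((m + 1 : ℕ) : ℝ) ^ (-(3 : ℝ) / 2) = (((m : ℝ) + 1) ^ ((3 : ℝ) / 2))⁻¹ := by
    rw [neg_div, Real.rpow_neg (by positivity)]
    push_cast
    rfl
  rw [Real.div_rpow (by positivity) hmp.le, e1, e2]
  have hZm : d / (2 * Real.pi) * Z m = (m : ℝ) * (Nat.card {θ : NCTree (m + 1) //
      ∀ v : Fin (m + 1), ncDeg (m + 1) θ v ∈ A} : ℝ) * Real.sqrt m / S4 ^ m := by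
    rw [hex, mul_assoc, mul_div_cancel_left₀ _ (by positivity)]
  rw [hZm]
  have h5 : 0 < ((m : ℝ) + 1) ^ ((3 : ℝ) / 2) := by positivity
  have h6 : 0 < Real.sqrt m := by positivity
  field_simp

/-- **Theorem 5.** Asymptotic enumeration of degree-constrained noncrossing
trees: if `1 ∈ A`, `A ≠ {1}`, `A ≠ {1,2}`, `b > 0` satisfies
`Σ_{k+1∈A} (k+1)(k-1)bᵏ = 0`, `d = gcd(A-1)` and
`K_A = d·sqrt(S₁/(2π S₃))·S₂` with `S₁ = Σ_{k+1∈A}(k+1)bᵏ`,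
`S₃ = Σ_{k+1∈A}(k+1)(k²-1)bᵏ`, `S₂ = Σ_{k∈A} k bᵏ`, then
`#NC_n^A ~ K_A · (Σ_{k+1∈A}(k+1)b^{k-1})^{n-1} · n^{-3/2}` along the subsequence of those `n`
for which `NC_n^A ≠ ∅`. -/
theorem card_degree_constrained_asymptotics (A : Set ℕ) (hA1 : 1 ∈ A)
    (hApos : ∀ a ∈ A, 1 ≤ a) (hne1 : A ≠ {1}) (hne12 : A ≠ ({1, 2} : Set ℕ))
    (b : ℝ) (hb : 0 < b)
    (hcrit : HasSum ({k : ℕ | k + 1 ∈ A}.indicator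
      fun k => ((k : ℝ) + 1) * ((k : ℝ) - 1) * b ^ k) 0)
    (d : ℕ) (hd_dvd : ∀ a ∈ A, d ∣ (a - 1))
    (hd_gcd : ∀ e : ℕ, (∀ a ∈ A, e ∣ (a - 1)) → e ∣ d)
    (S1 S2 S3 S4 : ℝ)
    (hS1 : HasSum ({k : ℕ | k + 1 ∈ A}.indicator fun k => ((k : ℝ) + 1) * b ^ k) S1)
    (hS2 : HasSum (A.indicator fun k => (k : ℝ) * b ^ k) S2)
    (hS3 : HasSum ({k : ℕ | k + 1 ∈ A}.indicator
      fun k => ((k : ℝ) + 1) * ((k : ℝ) ^ 2 - 1) * b ^ k) S3)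
    (hS4 : HasSum ({k : ℕ | k + 1 ∈ A}.indicator
      fun k => ((k : ℝ) + 1) * b ^ ((k : ℤ) - 1)) S4) :
    Filter.Tendsto
      (fun n : ℕ => (Nat.card {θ : NCTree n // ∀ v : Fin n, ncDeg n θ v ∈ A} : ℝ) /
        ((d : ℝ) * Real.sqrt (S1 / (2 * Real.pi * S3)) * S2 *
          S4 ^ (n - 1) * (n : ℝ) ^ (-(3 : ℝ) / 2)))
      (Filter.atTop ⊓ Filter.principal
        {n : ℕ | Nat.card {θ : NCTree n // ∀ v : Fin n, ncDeg n θ v ∈ A} ≠ 0})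
      (𝓝 1) := by
  exact nct_final A hA1 hApos hne1 hne12 b hb hcrit d hd_dvd hd_gcd S1 S2 S3 S4 hS1 hS2 hS3 hS4
end

section
/- Let A ⊆ ℕ = {1,2,…} with 1 ∈ A, A ≠ {1} and A ≠ {1,2}. Then there exists b ∈ (0,1) such that Σ_{k≥0, k+1∈A} (k+1)(k−1)b^k = 0. -/
/-- Let `A ⊆ {1,2,…}` with `1 ∈ A`, `A ≠ {1}` and `A ≠ {1,2}`. Then there
exists `b ∈ (0,1)` such that `Σ_{k ≥ 0, k+1 ∈ A} (k+1)(k-1)bᵏ = 0`. -/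
theorem exists_critical_parameter (A : Set ℕ) (hA1 : 1 ∈ A) (hApos : ∀ a ∈ A, 1 ≤ a)
    (hne1 : A ≠ {1}) (hne12 : A ≠ ({1, 2} : Set ℕ)) :
    ∃ b : ℝ, 0 < b ∧ b < 1 ∧
      HasSum ({k : ℕ | k + 1 ∈ A}.indicator
        fun k => ((k : ℝ) + 1) * ((k : ℝ) - 1) * b ^ k) 0 := by
  have hm : ∃ m : ℕ, 2 ≤ m ∧ m + 1 ∈ A := by
    by_contra! h
    have h' : ∀ a ∈ A, a = 1 ∨ a = 2 := by
      intro a ha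
      have h1 := hApos a ha
      by_contra hc
      apply h (a - 1) (by omega)
      rwa [Nat.sub_add_cancel h1]
    by_cases h2 : 2 ∈ A
    · apply hne12
      ext a
      simp only [Set.mem_insert_iff, Set.mem_singleton_iff]
      exact ⟨h' a, by rintro (rfl | rfl) <;> assumption⟩
    · apply hne1
      ext a
      simp only [Set.mem_singleton_iff]
      refine ⟨fun ha => ?_, by rintro rfl; assumption⟩
      rcases h' a ha with rfl | rfl
      · rfl
      · exact absurd ha h2
  obtain ⟨m, hm2, hmA⟩ := hm
  have hmR : (2 : ℝ) ≤ m := by exact_mod_cast hm2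
  obtain ⟨c, hc0, hc1, hcm⟩ : ∃ c : ℝ, 0 < c ∧ c < 1 ∧ 1 / 2 ≤ c ^ m := by
    have hpos : 0 < 1 / (2 * (m : ℝ)) := by positivity
    have hle : 1 / (2 * (m : ℝ)) ≤ 1 / 4 := by
      apply one_div_le_one_div_of_le <;> linarith
    refine ⟨1 + -(1 / (2 * m)), by linarith, by linarith, ?_⟩
    have := one_add_mul_le_pow (a := -(1 / (2 * (m : ℝ)))) (by linarith) m
    refine le_trans (le_of_eq ?_) this
    field_simp
    norm_num
  set S : Set ℕ := {k : ℕ | k + 1 ∈ A} with hS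
  set F : ℕ → ℝ → ℝ := fun k b =>
    S.indicator (fun k : ℕ => ((k : ℝ) + 1) * ((k : ℝ) - 1) * b ^ k) k with hF
  have hsum : Summable (fun k : ℕ => (k : ℝ) ^ 2 * c ^ k + c ^ k) := by
    have hn : ‖c‖ < 1 := by rwa [Real.norm_of_nonneg hc0.le]
    exact (summable_pow_mul_geometric_of_norm_lt_one 2 hn).add
      (summable_geometric_of_lt_one hc0.le hc1)
  have hbd : ∀ (k : ℕ) (b : ℝ), b ∈ Set.Icc 0 c → ‖F k b‖ ≤ (k : ℝ) ^ 2 * c ^ k + c ^ k := by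
    intro k b hb
    refine (norm_indicator_le_norm_self _ _).trans ?_
    rw [norm_mul, Real.norm_of_nonneg (pow_nonneg hb.1 k)]
    have h1 : b ^ k ≤ c ^ k := pow_le_pow_left₀ hb.1 hb.2 k
    have h2 : ‖((k : ℝ) + 1) * ((k : ℝ) - 1)‖ ≤ (k : ℝ) ^ 2 + 1 := by
      rw [Real.norm_eq_abs, abs_le]
      constructor <;> nlinarith [sq_nonneg (k : ℝ)]
    calc _ ≤ ((k : ℝ) ^ 2 + 1) * c ^ k :=
          mul_le_mul h2 h1 (pow_nonneg hb.1 k) (by positivity)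
      _ = _ := by ring
  have hsb : ∀ b ∈ Set.Icc 0 c, Summable (fun k => F k b) := fun b hb =>
    Summable.of_norm_bounded hsum (fun k => hbd k b hb)
  have hcont : ContinuousOn (fun b => ∑' k, F k b) (Set.Icc 0 c) := by
    refine continuousOn_tsum (fun k => ?_) hsum hbd
    by_cases hk : k ∈ S
    · simp only [hF, Set.indicator_of_mem hk]
      fun_prop
    · simp only [hF, Set.indicator_of_notMem hk]
      fun_prop
  have h0S : 0 ∈ S := by simpa [hS] using hA1
  have hmS : m ∈ S := hmA
  have hf0 : ∑' k, F k 0 = -1 := by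
    rw [tsum_eq_single 0]
    · simp [hF, Set.indicator_of_mem h0S]
    · intro k hk
      simp [hF, Set.indicator_apply, hk]
  have hfc : 0 ≤ ∑' k, F k c := by
    have h := (hsb c ⟨hc0.le, le_rfl⟩).sum_le_tsum {0, m} (by
      intro k hk
      have hk0 : k ≠ 0 := by
        rintro rfl
        simp at hk
      have h1 : (1 : ℝ) ≤ k := by exact_mod_cast Nat.one_le_iff_ne_zero.mpr hk0
      have h2 : 0 ≤ (k : ℝ) - 1 := by linarith
      by_cases hkS : k ∈ S
      · simp only [hF, Set.indicator_of_mem hkS]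
        positivity
      · simp only [hF, Set.indicator_of_notMem hkS]
        exact le_rfl)
    rw [Finset.sum_pair (by omega)] at h
    simp only [hF, Set.indicator_of_mem h0S, Set.indicator_of_mem hmS] at h
    refine le_trans ?_ h
    have h3 : 3 ≤ ((m : ℝ) + 1) * ((m : ℝ) - 1) := by nlinarith
    have := mul_le_mul h3 hcm (by norm_num) (by linarith)
    norm_num at this ⊢
    linarith
  obtain ⟨b, hb, hb0⟩ := intermediate_value_Icc hc0.le hcont
    (show (0 : ℝ) ∈ Set.Icc _ _ from ⟨by simp only [hf0]; norm_num, hfc⟩)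
  refine ⟨b, lt_of_le_of_ne hb.1 ?_, hb.2.trans_lt hc1, ?_⟩
  · rintro rfl
    simp only [hf0] at hb0
    norm_num at hb0
  · have := (hsb b hb).hasSum
    simp only at hb0
    rw [hb0] at this
    exact this
end
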